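/- arXiv:math/0305286 — 3 statements merged into one kernel-verified Lean document; each statement's English description precedes it below -/
import Mathlib

section
/- (Fedder type criterion for F-purity.) Let (R, m) be an F-finite regular local ring of prime characteristic p > 0 and I ⊊ R a reduced ideal. Let a₁,…,a_k be ideals of R, t₁,…,t_k > 0 real numbers, and write S = R/I. Then the pair (S, (a₁S)^{t₁}⋯(a_kS)^{t_k}) is F-pure if and only if for all sufficiently large powers q = p^e one has a₁^{⌊t₁(q−1)⌋}⋯a_k^{⌊t_k(q−1)⌋} · (I^{[q]} : I) ⊄ m^{[q]}. -/
/-!  Common definitions: F-singularities of pairs `(R, a₁^{t₁} ⋯ a_k^{t_k})`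
(Takagi, "F-singularities of pairs and Inversion of Adjunction of arbitrary
codimension"). -/

/-- The subring of `p`-th powers of `R`. -/
def pthPowers (R : Type*) [CommRing R] (p : ℕ) : Subring R :=
  Subring.closure (Set.range fun x : R => x ^ p)

/-- `R` is F-finite: it is a finitely generated module over its subring of `p`-th powers. -/
def FFinite (R : Type*) [CommRing R] (p : ℕ) : Prop :=
  Module.Finite (pthPowers R p) R

/-- `c^{1/q} R → R^{1/q}` splits as an `R`-module homomorphism: there is an additive
map `φ : R → R` with `φ (a ^ q * x) = a * φ x` for all `a x` and `φ c = 1`. -/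
def SplitsAlong (R : Type*) [CommRing R] (c : R) (q : ℕ) : Prop :=
  ∃ φ : R →+ R, (∀ a x : R, φ (a ^ q * x) = a * φ x) ∧ φ c = 1

/-- Membership in `R°`: `c` lies in no minimal prime of `R`. -/
def NotInMinimalPrimes (R : Type*) [CommRing R] (c : R) : Prop :=
  ∀ P ∈ minimalPrimes R, c ∉ P

/-- F-purity of the pair `(R, a₁^{t₁} ⋯ a_k^{t_k})`: for all sufficiently large
`q = p^e` there is `d ∈ a₁^{⌊t₁(q-1)⌋} ⋯ a_k^{⌊t_k(q-1)⌋}` such that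
`d^{1/q} R → R^{1/q}` splits. -/
def FPurePair (R : Type*) [CommRing R] (p : ℕ) {k : ℕ}
    (a : Fin k → Ideal R) (t : Fin k → ℝ) : Prop :=
  ∃ e₀ : ℕ, ∀ e : ℕ, e₀ ≤ e →
    ∃ d ∈ ∏ i, a i ^ ⌊t i * ((p ^ e : ℝ) - 1)⌋₊, SplitsAlong R d (p ^ e)

/-- Strong F-regularity of the pair `(R, a₁^{t₁} ⋯ a_k^{t_k})`: for every `c ∈ R°`
there are `q = p^e` and `d ∈ a₁^{⌊t₁(q-1)⌋} ⋯ a_k^{⌊t_k(q-1)⌋}` such that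
`(cd)^{1/q} R → R^{1/q}` splits. -/
def StronglyFRegularPair (R : Type*) [CommRing R] (p : ℕ) {k : ℕ}
    (a : Fin k → Ideal R) (t : Fin k → ℝ) : Prop :=
  ∀ c : R, NotInMinimalPrimes R c →
    ∃ e : ℕ, ∃ d ∈ ∏ i, a i ^ ⌊t i * ((p ^ e : ℝ) - 1)⌋₊, SplitsAlong R (c * d) (p ^ e)

/-- Pure F-regularity of the pair `(R, a₁^{t₁} ⋯ a_k^{t_k})`: for every `c ∈ R°` not
in any minimal prime of `a₁ ⋯ a_k`, for all sufficiently large `q = p^e` there is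
`d ∈ a₁^{⌊t₁(q-1)⌋} ⋯ a_k^{⌊t_k(q-1)⌋}` such that `(cd)^{1/q} R → R^{1/q}` splits. -/
def PurelyFRegularPair (R : Type*) [CommRing R] (p : ℕ) {k : ℕ}
    (a : Fin k → Ideal R) (t : Fin k → ℝ) : Prop :=
  ∀ c : R, NotInMinimalPrimes R c → (∀ P ∈ (∏ i, a i).minimalPrimes, c ∉ P) →
    ∃ e₀ : ℕ, ∀ e : ℕ, e₀ ≤ e →
      ∃ d ∈ ∏ i, a i ^ ⌊t i * ((p ^ e : ℝ) - 1)⌋₊, SplitsAlong R (c * d) (p ^ e)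

/-- A strongly F-regular ring: for every `c ∈ R°` there is `q = p^e` such that
`c^{1/q} R → R^{1/q}` splits. -/
def StronglyFRegularRing (R : Type*) [CommRing R] (p : ℕ) : Prop :=
  ∀ c : R, NotInMinimalPrimes R c → ∃ e : ℕ, SplitsAlong R c (p ^ e)

/-- The Frobenius power `J^{[q]}`, the ideal generated by `q`-th powers of elements
of `J`. -/
def frobeniusPower {R : Type*} [CommRing R] (J : Ideal R) (q : ℕ) : Ideal R :=
  Ideal.span ((fun x => x ^ q) '' (J : Set R))

/-- A regular local ring: a Noetherian local ring whose maximal ideal is generated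
by `dim R` elements. -/
def IsRegularLocal (R : Type*) [CommRing R] [IsLocalRing R] : Prop :=
  IsNoetherianRing R ∧
    ∃ s : Finset R, Ideal.span (s : Set R) = IsLocalRing.maximalIdeal R ∧
      (s.card : WithBot ℕ∞) = ringKrullDim R

/-- The height of a prime ideal. -/
noncomputable def primeHeight {R : Type*} [CommRing R] (P : Ideal R) (hP : P.IsPrime) : ℕ∞ :=
  Order.height (⟨P, hP⟩ : PrimeSpectrum R)

/-- `I` is an unmixed reduced ideal of height `h`: `I` is radical and every minimal
prime of `I` has height `h`. -/
def UnmixedReducedOfHeight {R : Type*} [CommRing R] (I : Ideal R) (h : ℕ) : Prop :=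
  I.IsRadical ∧ ∀ (P : Ideal R) (hP : P.IsPrime), P ∈ I.minimalPrimes →
    primeHeight P hP = (h : ℕ∞)

namespace Fedder
open IsLocalRing RingTheory.Sequence

theorem exists_exchange {R : Type*} [CommRing R] [IsLocalRing R] (rs : List R) (x : R)
    (hx : x ∈ Ideal.ofList rs) (hx' : x ∉ maximalIdeal R * Ideal.ofList rs) :
    ∃ rest : List R, rest.length + 1 = rs.length ∧
      Ideal.span {x} ⊔ Ideal.ofList rest = Ideal.ofList rs := by
  induction rs generalizing x with
  | nil =>
    rw [Ideal.ofList_nil, Ideal.mem_bot] at hx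
    exact absurd (hx ▸ zero_mem _) hx'
  | cons a l ih =>
    rw [Ideal.ofList_cons] at hx hx' ⊢
    obtain ⟨b, hb, y, hy, rfl⟩ := Submodule.mem_sup.1 hx
    obtain ⟨c, rfl⟩ := Ideal.mem_span_singleton'.1 hb
    by_cases hc : IsUnit c
    · refine ⟨l, rfl, le_antisymm (sup_le ?_ le_sup_right) (sup_le ?_ le_sup_right)⟩
      · rwa [Ideal.span_singleton_le_iff_mem]
      · rw [Ideal.span_singleton_le_iff_mem, ← Ideal.unit_mul_mem_iff_mem _ hc,
          ← Ideal.add_mem_iff_left _ (Ideal.mem_sup_right hy)]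
        exact Ideal.mem_sup_left (Ideal.mem_span_singleton_self _)
    · have hca : c * a ∈ maximalIdeal R * (Ideal.span {a} ⊔ Ideal.ofList l) :=
        Ideal.mul_mem_mul hc (Ideal.mem_sup_left (Ideal.mem_span_singleton_self a))
      obtain ⟨rest, hlen, hrest⟩ := ih y hy fun h => hx' <|
        add_mem hca (Ideal.mul_mono_right le_sup_right h)
      refine ⟨a :: rest, by simp [hlen], ?_⟩
      rw [Ideal.ofList_cons, ← hrest]
      refine le_antisymm (sup_le ?_ (sup_le le_sup_left ?_)) (sup_le ?_ (sup_le ?_ ?_))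
      · rw [hrest]
        rwa [Ideal.span_singleton_le_iff_mem]
      · exact le_sup_right.trans le_sup_right
      · exact le_sup_left.trans le_sup_right
      · rw [Ideal.span_singleton_le_iff_mem]
        refine (Ideal.add_mem_iff_right _ (a := c * a) ?_).1
          (Ideal.mem_sup_left (Ideal.mem_span_singleton_self _))
        exact Ideal.mem_sup_right
          (Ideal.mem_sup_left (Ideal.mem_span_singleton'.2 ⟨c, rfl⟩))
      · exact le_sup_right.trans le_sup_right

theorem ringKrullDim_le_length {R : Type*} [CommRing R] [IsLocalRing R] [IsNoetherianRing R]
    (rs : List R) (h : Ideal.ofList rs = maximalIdeal R) : ringKrullDim R ≤ rs.length := by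
  refine (ringKrullDim_le_spanFinrank_maximalIdeal R).trans ?_
  classical
  rw [← h, show Ideal.ofList rs = Ideal.span (rs.toFinset : Set R) by simp [Ideal.ofList]]
  have := (Submodule.spanFinrank_span_le_ncard_of_finite (R := R) rs.toFinset.finite_toSet)
  rw [Set.ncard_coe_finset] at this
  exact_mod_cast this.trans (List.toFinset_card_le rs)

theorem nontrivial_quotient_span {R : Type*} [CommRing R] [IsLocalRing R] {x : R}
    (hx : x ∈ maximalIdeal R) : Nontrivial (R ⧸ Ideal.span {x}) := by
  rw [Ideal.Quotient.nontrivial_iff, Ne, Ideal.span_singleton_eq_top]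
  exact hx

theorem ofList_map_mk_eq_maximalIdeal {R : Type*} [CommRing R] [IsLocalRing R]
    {x : R} {rest : List R} (h : Ideal.span {x} ⊔ Ideal.ofList rest = maximalIdeal R)
    [IsLocalRing (R ⧸ Ideal.span {x})] :
    Ideal.ofList (rest.map (Ideal.Quotient.mk (Ideal.span {x}))) =
      maximalIdeal (R ⧸ Ideal.span {x}) := by
  rw [← Ideal.map_ofList, ← map_maximalIdeal_of_surjective _
    (Ideal.Quotient.mk_surjective (I := Ideal.span {x})), ← h, Ideal.map_sup,
    Ideal.map_quotient_self, bot_sup_eq]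

theorem ringKrullDim_quotient_span {R : Type*} [CommRing R] [IsLocalRing R] [IsNoetherianRing R]
    {x : R} {rest : List R} (h : Ideal.span {x} ⊔ Ideal.ofList rest = maximalIdeal R)
    (hdim : ringKrullDim R = (rest.length + 1 : ℕ)) [IsLocalRing (R ⧸ Ideal.span {x})] :
    ringKrullDim (R ⧸ Ideal.span {x}) = rest.length := by
  have hx : x ∈ maximalIdeal R := h ▸ Ideal.mem_sup_left (Ideal.mem_span_singleton_self x)
  refine le_antisymm ?_ ?_
  · simpa using ringKrullDim_le_length _ (ofList_map_mk_eq_maximalIdeal h)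
  · have := ringKrullDim_le_ringKrullDim_quotient_add_encard {x}
      (by simpa [ringJacobson_eq_maximalIdeal] using hx)
    rw [hdim, Set.encard_singleton] at this
    generalize ringKrullDim (R ⧸ Ideal.span {x}) = d at this ⊢
    cases d with
    | bot => exact absurd this (by simp)
    | coe d =>
      cases d with
      | top => exact WithBot.coe_le_coe.2 le_top
      | coe d =>
        norm_cast at this ⊢
        omega

theorem exists_mem_maximalIdeal_notMem {R : Type*} [CommRing R] [IsLocalRing R]
    [IsNoetherianRing R] (hdim : ringKrullDim R ≠ 0) :
    ∃ x ∈ maximalIdeal R, x ∉ maximalIdeal R * maximalIdeal R ∧ ∀ P ∈ minimalPrimes R, x ∉ P := by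
  by_contra! H
  have hfin := minimalPrimes.finite_of_isNoetherianRing R
  have hsub : (maximalIdeal R : Set R) ⊆
      ((maximalIdeal R * maximalIdeal R : Ideal R) : Set R) ∪
        (maximalIdeal R * maximalIdeal R : Ideal R) ∪
        ⋃ i ∈ (hfin.toFinset : Set (Ideal R)), (id i : Ideal R) := by
    intro x hx
    by_cases hx2 : x ∈ maximalIdeal R * maximalIdeal R
    · exact Or.inl (Or.inl hx2)
    · obtain ⟨P, hP, hxP⟩ := H x hx hx2
      exact Or.inr (Set.mem_biUnion (by simpa using hP) hxP)
  have hsq : maximalIdeal R ≤ maximalIdeal R * maximalIdeal R → False := by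
    intro hle
    have h0 : maximalIdeal R = ⊥ :=
      Submodule.eq_bot_of_le_smul_of_le_jacobson_bot (maximalIdeal R) _
        (IsNoetherian.noetherian _) hle (maximalIdeal_le_jacobson _)
    exact hdim (ringKrullDim_eq_zero_of_isField (isField_iff_maximalIdeal_eq.2 h0))
  have hprime : ∀ i ∈ hfin.toFinset, Ideal.IsPrime (id i) := by
    intro P hP
    exact (hfin.mem_toFinset.1 hP).1.1
  have havoid : maximalIdeal R ≤ maximalIdeal R * maximalIdeal R ∨
      maximalIdeal R ≤ maximalIdeal R * maximalIdeal R ∨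
      ∃ i ∈ hfin.toFinset.map Function.Embedding.some, maximalIdeal R ≤
        (fun i : Option (Ideal R) => i.elim (maximalIdeal R * maximalIdeal R) id) i := by
    refine (Ideal.subset_union_prime' (f := fun i : Option (Ideal R) =>
      i.elim (maximalIdeal R * maximalIdeal R) id) (a := none) (b := none)
      (s := hfin.toFinset.map Function.Embedding.some) ?_).1 ?_
    · simp only [Finset.mem_map]
      rintro _ ⟨P, hP, rfl⟩
      exact hprime P hP
    · simpa using hsub
  rcases havoid with h | h | ⟨P, hP, h⟩
  · exact hsq h
  · exact hsq h
  · simp only [Finset.mem_map, Set.Finite.mem_toFinset] at hP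
    obtain ⟨P, hP, rfl⟩ := hP
    have hPm : P = maximalIdeal R := le_antisymm (le_maximalIdeal hP.1.1.ne_top) h
    have : Ring.KrullDimLE 0 R := Ring.krullDimLE_zero_iff.2 fun Q hQ => by
      have := hP.2 ⟨hQ, bot_le⟩ (hPm ▸ le_maximalIdeal hQ.ne_top)
      rw [le_antisymm (le_maximalIdeal hQ.ne_top) (hPm ▸ this)]
      infer_instance
    exact hdim (ringKrullDimZero_iff_ringKrullDim_eq_zero.1 this)

theorem isDomain_of_ofList_eq_maximalIdeal {R : Type*} [CommRing R] [IsLocalRing R]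
    [IsNoetherianRing R] (rs : List R) (h : Ideal.ofList rs = maximalIdeal R)
    (hdim : ringKrullDim R = rs.length) : IsDomain R := by
  induction hn : rs.length generalizing R with
  | zero =>
    rw [List.length_eq_zero_iff.1 hn, Ideal.ofList_nil] at h
    exact (isField_iff_maximalIdeal_eq.2 h.symm).isDomain
  | succ n ih =>
    obtain ⟨x, hx, hx2, hxP⟩ := exists_mem_maximalIdeal_notMem (R := R) (by
      rw [hdim, hn]; exact_mod_cast n.succ_ne_zero)
    obtain ⟨rest, hlen, hrest⟩ := exists_exchange rs x (h ▸ hx) (h ▸ hx2)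
    have := nontrivial_quotient_span hx
    have := IsLocalRing.of_surjective' _ (Ideal.Quotient.mk_surjective (I := Ideal.span {x}))
    rw [h] at hrest
    have hdom := ih (R := R ⧸ Ideal.span {x}) _ (ofList_map_mk_eq_maximalIdeal hrest)
      (by simpa using ringKrullDim_quotient_span hrest (by rw [hdim, hlen])) (by simp; omega)
    have hprime := (Ideal.Quotient.isDomain_iff_prime _).1 hdom
    obtain ⟨P, hP, hPx⟩ := Ideal.exists_minimalPrimes_le (I := ⊥) (J := Ideal.span {x}) bot_le
    have hPprime : P.IsPrime := hP.1.1
    have hP0 : P = ⊥ := by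
      refine Submodule.eq_bot_of_le_smul_of_le_jacobson_bot (Ideal.span {x}) _
        (IsNoetherian.noetherian _) ?_ ?_
      · intro y hy
        obtain ⟨c, rfl⟩ := Ideal.mem_span_singleton'.1 (hPx hy)
        rw [mul_comm, smul_eq_mul]
        exact Ideal.mul_mem_mul (Ideal.mem_span_singleton_self x)
          ((hPprime.mem_or_mem hy).resolve_right (hxP P hP))
      · rw [Ideal.span_singleton_le_iff_mem]
        exact maximalIdeal_le_jacobson _ hx
    subst hP0
    exact IsDomain.of_bot_isPrime R

open scoped Pointwise in
theorem isWeaklyRegular_of_ofList_eq_maximalIdeal {R : Type*} [CommRing R] [IsLocalRing R]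
    [IsNoetherianRing R] (rs : List R) (h : Ideal.ofList rs = maximalIdeal R)
    (hdim : ringKrullDim R = rs.length) : IsWeaklyRegular R rs := by
  induction hn : rs.length generalizing R rs with
  | zero =>
    rw [List.length_eq_zero_iff.1 hn]
    exact .nil R R
  | succ n ih =>
    obtain ⟨x, rest, rfl⟩ := List.exists_cons_of_length_eq_add_one hn
    have := isDomain_of_ofList_eq_maximalIdeal _ h hdim
    have hrest := h
    rw [Ideal.ofList_cons] at hrest
    have hx : x ∈ maximalIdeal R := hrest ▸ Ideal.mem_sup_left (Ideal.mem_span_singleton_self x)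
    have := nontrivial_quotient_span hx
    have := IsLocalRing.of_surjective' _ (Ideal.Quotient.mk_surjective (I := Ideal.span {x}))
    have key := ih (R := R ⧸ Ideal.span {x}) _ (ofList_map_mk_eq_maximalIdeal hrest)
      (by simpa using ringKrullDim_quotient_span hrest hdim) (by simpa using hn)
    refine IsWeaklyRegular.cons ?_ ?_
    · have hx0 : x ≠ 0 := by
        rintro rfl
        have h1 := ringKrullDim_le_length rest (by simpa using hrest)
        rw [hdim] at h1
        simp only [List.length_cons] at h1
        exact absurd (by exact_mod_cast h1) (Nat.not_succ_le_self rest.length)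
      exact (IsRegular.of_ne_zero hx0).left.isSMulRegular
    · have e : (x • (⊤ : Submodule R R)) = Ideal.span {x} := by
        rw [← Submodule.ideal_span_singleton_smul, smul_eq_mul, Ideal.mul_top]
      refine ((Submodule.quotEquivOfEq _ _ e).isWeaklyRegular_congr rest).2 ?_
      exact (isWeaklyRegular_map_algebraMap_iff (R := R) (S := R ⧸ Ideal.span {x})
        (M := R ⧸ Ideal.span {x}) rest).1 key

theorem ofList_eq_of_perm {R : Type*} [CommRing R] {l l' : List R} (h : l.Perm l') :
    Ideal.ofList l = Ideal.ofList l' := by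
  simp only [Ideal.ofList, h.mem_iff]

theorem isWeaklyRegular_map_pow_append {R : Type*} [CommRing R] [IsLocalRing R]
    [IsNoetherianRing R] {n : ℕ} (hn : n ≠ 0) (l₁ l₂ : List R)
    (hmem : ∀ r ∈ l₁ ++ l₂, r ∈ maximalIdeal R) (h : IsWeaklyRegular R (l₁ ++ l₂)) :
    IsWeaklyRegular R (l₁.map (· ^ n) ++ l₂) := by
  induction l₁ generalizing l₂ with
  | nil => exact h
  | cons x l ih =>
    have hx : x ∈ maximalIdeal R := hmem x (by simp)
    have h1 : IsWeaklyRegular R ((l ++ l₂) ++ [x]) :=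
      isWeaklyRegular_of_perm_of_subset_maximalIdeal h
        (List.perm_append_singleton x (l ++ l₂)).symm hmem
    rw [isWeaklyRegular_append_iff, isWeaklyRegular_singleton_iff] at h1
    have h2 : IsWeaklyRegular R (l ++ (l₂ ++ [x ^ n])) := by
      rw [← List.append_assoc, isWeaklyRegular_append_iff, isWeaklyRegular_singleton_iff]
      exact ⟨h1.1, h1.2.pow n⟩
    have hmem' : ∀ r ∈ l ++ (l₂ ++ [x ^ n]), r ∈ maximalIdeal R := by
      intro r hr
      simp only [List.mem_append, List.mem_singleton] at hr
      rcases hr with hr | hr | rfl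
      · exact hmem r (by simp [hr])
      · exact hmem r (by simp [hr])
      · exact Ideal.pow_mem_of_mem _ hx n (Nat.pos_of_ne_zero hn)
    have h3 := ih _ hmem' h2
    refine isWeaklyRegular_of_perm_of_subset_maximalIdeal h3 ?_ ?_
    · rw [← List.append_assoc]
      exact List.perm_append_singleton _ _
    · intro r hr
      simp only [List.mem_append, List.mem_map, List.mem_singleton] at hr
      rcases hr with ⟨s, hs, rfl⟩ | hr | rfl
      · exact Ideal.pow_mem_of_mem _ (hmem s (by simp [hs])) n (Nat.pos_of_ne_zero hn)
      · exact hmem r (by simp [hr])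
      · exact Ideal.pow_mem_of_mem _ hx n (Nat.pos_of_ne_zero hn)

theorem prod_pow_notMem {R : Type*} [CommRing R] [IsLocalRing R]
    [IsNoetherianRing R] (n : ℕ) (l₁ l₂ : List R)
    (hmem : ∀ r ∈ l₁ ++ l₂, r ∈ maximalIdeal R) (h : IsWeaklyRegular R (l₁ ++ l₂)) :
    (l₁.map (· ^ n)).prod ∉ Ideal.ofList (l₁.map (· ^ (n + 1)) ++ l₂) := by
  induction l₁ generalizing l₂ with
  | nil =>
    intro h1
    refine (Ideal.ne_top_iff_one _).1 (maximalIdeal.isMaximal R).ne_top ?_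
    exact Ideal.span_le.2 (fun r hr => hmem r hr) h1
  | cons x l ih =>
    intro h1
    have h2 : IsWeaklyRegular R ((l.map (· ^ (n + 1)) ++ l₂) ++ [x]) := by
      rw [List.append_assoc]
      refine isWeaklyRegular_map_pow_append n.succ_ne_zero _ _ ?_ ?_
      · intro r hr
        exact hmem r (by simp at hr ⊢; tauto)
      · rw [← List.append_assoc]
        exact isWeaklyRegular_of_perm_of_subset_maximalIdeal h
          (List.perm_append_singleton x (l ++ l₂)).symm hmem
    rw [isWeaklyRegular_append_iff, isWeaklyRegular_singleton_iff] at h2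
    have h3 := h2.2
    rw [isSMulRegular_quotient_iff_mem_of_smul_mem] at h3
    simp only [smul_eq_mul, Ideal.mul_top] at h3
    have hpow : ∀ (k : ℕ) (y : R), x ^ k * y ∈ Ideal.ofList (l.map (· ^ (n + 1)) ++ l₂) →
        y ∈ Ideal.ofList (l.map (· ^ (n + 1)) ++ l₂) := by
      intro k
      induction k with
      | zero => intro y hy; simpa using hy
      | succ k ihk =>
        intro y hy
        exact ihk y (h3 _ (by rwa [pow_succ', mul_assoc] at hy))
    simp only [List.map_cons, List.cons_append, Ideal.ofList_cons, List.prod_cons] at h1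
    obtain ⟨b, hb, c, hc, hbc⟩ := Submodule.mem_sup.1 h1
    obtain ⟨w, rfl⟩ := Ideal.mem_span_singleton'.1 hb
    have h4 := hpow n ((l.map (· ^ n)).prod - w * x) (by
      convert hc using 1
      linear_combination -hbc)
    refine ih (x :: l₂) ?_ ?_ ?_
    · intro r hr
      exact hmem r (by simp at hr ⊢; tauto)
    · exact isWeaklyRegular_of_perm_of_subset_maximalIdeal h List.perm_middle.symm hmem
    · rw [ofList_eq_of_perm List.perm_middle, Ideal.ofList_cons]
      rw [← sub_add_cancel (l.map (· ^ n)).prod (w * x)]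
      exact add_mem (Ideal.mem_sup_right h4)
        (Ideal.mem_sup_left (Ideal.mul_mem_left _ _ (Ideal.mem_span_singleton_self x)))

/-- Every nonzero ideal of `R ⧸ K` contains the class of `s`. -/
def IsSocleGenerator {R : Type*} [CommRing R] (K : Ideal R) (s : R) : Prop :=
  ∀ z ∉ K, ∃ y, z * y - s ∈ K

theorem IsSocleGenerator.pow {R : Type*} [CommRing R] {K : Ideal R} {s x : R}
    (h : IsSocleGenerator (Ideal.span {x} ⊔ K) s) (n : ℕ) :
    IsSocleGenerator (Ideal.span {x ^ (n + 1)} ⊔ K) (x ^ n * s) := by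
  induction n with
  | zero => simpa using h
  | succ n ih =>
    intro z hz
    by_cases hz' : z ∈ Ideal.span {x ^ (n + 1)} ⊔ K
    · obtain ⟨b, hb, c, hc, rfl⟩ := Submodule.mem_sup.1 hz'
      obtain ⟨w, rfl⟩ := Ideal.mem_span_singleton'.1 hb
      have hw : w ∉ Ideal.span {x} ⊔ K := by
        intro hw
        obtain ⟨b, hb', d, hd, rfl⟩ := Submodule.mem_sup.1 hw
        obtain ⟨u, rfl⟩ := Ideal.mem_span_singleton'.1 hb'
        refine hz (Submodule.mem_sup.2 ⟨u * x ^ (n + 1 + 1),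
          Ideal.mem_span_singleton'.2 ⟨u, rfl⟩, d * x ^ (n + 1) + c,
          add_mem (Ideal.mul_mem_right _ _ hd) hc, by ring⟩)
      obtain ⟨y, hy⟩ := h w hw
      obtain ⟨b, hb', d, hd, hbd⟩ := Submodule.mem_sup.1 hy
      obtain ⟨u, rfl⟩ := Ideal.mem_span_singleton'.1 hb'
      refine ⟨y, Submodule.mem_sup.2 ⟨u * x ^ (n + 1 + 1),
          Ideal.mem_span_singleton'.2 ⟨u, rfl⟩, d * x ^ (n + 1) + c * y,
          add_mem (Ideal.mul_mem_right _ _ hd) (Ideal.mul_mem_right _ _ hc), ?_⟩⟩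
      linear_combination x ^ (n + 1) * hbd
    · obtain ⟨y, hy⟩ := ih z hz'
      obtain ⟨b, hb', d, hd, hbd⟩ := Submodule.mem_sup.1 hy
      obtain ⟨u, rfl⟩ := Ideal.mem_span_singleton'.1 hb'
      refine ⟨x * y, Submodule.mem_sup.2 ⟨u * x ^ (n + 1 + 1),
          Ideal.mem_span_singleton'.2 ⟨u, rfl⟩, d * x, Ideal.mul_mem_right _ _ hd, ?_⟩⟩
      linear_combination x * hbd

theorem isSocleGenerator_prod_pow {R : Type*} [CommRing R] (n : ℕ) (l₁ l₂ : List R)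
    (h : IsSocleGenerator (Ideal.ofList (l₁ ++ l₂)) 1) :
    IsSocleGenerator (Ideal.ofList (l₁.map (· ^ (n + 1)) ++ l₂)) (l₁.map (· ^ n)).prod := by
  induction l₁ generalizing l₂ with
  | nil => exact h
  | cons x l ih =>
    have h1 := ih (x :: l₂) (by rwa [ofList_eq_of_perm List.perm_middle])
    rw [ofList_eq_of_perm List.perm_middle, Ideal.ofList_cons] at h1
    simpa using h1.pow n

theorem isSocleGenerator_maximalIdeal (R : Type*) [CommRing R] [IsLocalRing R] :
    IsSocleGenerator (maximalIdeal R) 1 := by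
  intro z hz
  obtain ⟨y, hy⟩ := (notMem_maximalIdeal.1 hz).exists_right_inv
  exact ⟨y, by simp [hy]⟩

open scoped Pointwise in
theorem free_of_isWeaklyRegular {R : Type*} [CommRing R] [IsLocalRing R] [IsNoetherianRing R]
    (M : Type*) [AddCommGroup M] [Module R M] [Module.Finite R M] (rs : List R)
    (h : Ideal.ofList rs = maximalIdeal R) (hM : IsWeaklyRegular M rs) : Module.Free R M := by
  induction hn : rs.length generalizing R M rs with
  | zero =>
    rw [List.length_eq_zero_iff.1 hn, Ideal.ofList_nil] at h
    let := (isField_iff_maximalIdeal_eq.2 h.symm).toField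
    infer_instance
  | succ n ih =>
    obtain ⟨x, rest, rfl⟩ := List.exists_cons_of_length_eq_add_one hn
    rw [Ideal.ofList_cons] at h
    have hx : x ∈ maximalIdeal R := h ▸ Ideal.mem_sup_left (Ideal.mem_span_singleton_self x)
    have := nontrivial_quotient_span hx
    have := IsLocalRing.of_surjective' _ (Ideal.Quotient.mk_surjective (I := Ideal.span {x}))
    rw [isWeaklyRegular_cons_iff'] at hM
    have := Module.finitePresentation_of_finite R M
    have := Module.Finite.of_restrictScalars_finite R (R ⧸ Ideal.span {x}) (QuotSMulTop x M)
    refine (Module.free_quotSMulTop_iff_free R M (maximalIdeal_le_jacobson _ hx) hM.1).1 ?_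
    exact ih (QuotSMulTop x M) _ (ofList_map_mk_eq_maximalIdeal h) hM.2 (by simpa using hn)

theorem apply_mem_of_mem_map {R A : Type*} [CommRing R] [CommRing A] [Algebra R A]
    {J : Ideal R} (θ : A →ₗ[R] R) {x : A} (hx : x ∈ J.map (algebraMap R A)) : θ x ∈ J := by
  have hx' : x ∈ J • (⊤ : Submodule R A) := by
    rwa [Ideal.smul_top_eq_map]
  have h2 := Submodule.mem_map_of_mem (f := θ) hx'
  rw [Submodule.map_smul''] at h2
  exact (Ideal.mul_le_left : J * Submodule.map θ ⊤ ≤ J) h2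

theorem mem_map_of_forall_apply_mem {R A : Type*} [CommRing R] [CommRing A] [Algebra R A]
    [Module.Finite R A] [Module.Free R A] {J : Ideal R} {x : A}
    (h : ∀ θ : A →ₗ[R] R, θ x ∈ J) : x ∈ J.map (algebraMap R A) := by
  let b := Module.Free.chooseBasis R A
  rw [← b.sum_repr x]
  refine sum_mem fun i _ => ?_
  rw [Algebra.smul_def]
  exact Ideal.mul_mem_right _ _ (Ideal.mem_map_of_mem _ (h (b.coord i)))

theorem exists_apply_eq_one {R A : Type*} [CommRing R] [IsLocalRing R] [CommRing A] [Algebra R A]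
    [Module.Finite R A] [Module.Free R A] {x : A}
    (h : x ∉ (maximalIdeal R).map (algebraMap R A)) : ∃ θ : A →ₗ[R] R, θ x = 1 := by
  by_contra! H
  refine h (mem_map_of_forall_apply_mem fun θ => ?_)
  by_contra hθ
  obtain ⟨y, hy⟩ := (notMem_maximalIdeal.1 hθ).exists_left_inv
  exact H (y • θ) hy

theorem exists_dualizing_form {R A : Type*} [CommRing R] [IsLocalRing R] [CommRing A]
    [Algebra R A] [Module.Finite R A] [Module.Free R A] (s : A)
    (hs : s ∉ (maximalIdeal R).map (algebraMap R A))
    (hsoc : IsSocleGenerator ((maximalIdeal R).map (algebraMap R A)) s) :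
    ∃ Φ : A →ₗ[R] R, ∀ φ : A →ₗ[R] R, ∃ f : A, ∀ x, φ x = Φ (f * x) := by
  classical
  obtain ⟨Φ, hΦ⟩ := exists_apply_eq_one hs
  let b := Module.Free.chooseBasis R A
  let B : Matrix _ _ R := Matrix.of fun j i => Φ (b i * b j)
  have hB : ∀ v : _ → R, ∀ j, (B.mulVec v) j = Φ ((∑ i, v i • b i) * b j) := by
    intro v j
    simp [B, Matrix.mulVec, dotProduct, Finset.sum_mul, mul_comm (Φ _)]
  have hdet : IsUnit B.det := by
    by_contra hdet
    have h0 : (B.map (residue R)).det = 0 := by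
      rw [← RingHom.mapMatrix_apply, ← RingHom.map_det, residue_eq_zero_iff]
      exact hdet
    obtain ⟨v, hv0, hv⟩ := Matrix.exists_mulVec_eq_zero_iff.2 h0
    choose w hw using fun i => residue_surjective (v i)
    obtain ⟨i, hi⟩ := Function.ne_iff.1 hv0
    have hz : ∑ i, w i • b i ∉ (maximalIdeal R).map (algebraMap R A) := by
      intro hz
      have := apply_mem_of_mem_map (b.coord i) hz
      simp only [map_sum, map_smul, Module.Basis.coord_apply, Module.Basis.repr_self] at this
      simp [Finsupp.single_apply] at this
      have hmem : w i ∈ maximalIdeal R := this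
      rw [← residue_eq_zero_iff, hw] at hmem
      exact hi hmem
    obtain ⟨y, hy⟩ := hsoc _ hz
    have hy1 := apply_mem_of_mem_map Φ hy
    have hy2 : Φ ((∑ i, w i • b i) * y) ∈ maximalIdeal R := by
      rw [← b.sum_repr y, Finset.mul_sum, map_sum]
      refine sum_mem fun j _ => ?_
      rw [mul_smul_comm, map_smul]
      refine Ideal.mul_mem_left _ _ ?_
      rw [← hB, ← residue_eq_zero_iff]
      have := congrFun hv j
      rw [Pi.zero_apply] at this
      rw [← this]
      simp [Matrix.mulVec, dotProduct, ← hw]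
    rw [map_sub, hΦ] at hy1
    have h1 : (1 : R) ∈ maximalIdeal R := by simpa using sub_mem hy2 hy1
    exact (Ideal.ne_top_iff_one _).1 (maximalIdeal.isMaximal R).ne_top h1
  refine ⟨Φ, fun φ => ?_⟩
  let v := B⁻¹.mulVec fun j => φ (b j)
  refine ⟨∑ i, v i • b i, fun x => ?_⟩
  have heq : φ = Φ ∘ₗ LinearMap.mulLeft R (∑ i, v i • b i) := by
    refine b.ext fun j => ?_
    rw [LinearMap.comp_apply, LinearMap.mulLeft_apply, ← hB]
    simp [v, Matrix.mulVec_mulVec, Matrix.mul_nonsing_inv _ hdet]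
  exact LinearMap.congr_fun heq x

/-- The ring `R` viewed as an `R`-algebra through the `e`-th iterate of the Frobenius. -/
def FrobeniusPushforward (R : Type*) (_p _e : ℕ) : Type _ := R

namespace FrobeniusPushforward

variable (R : Type*) [CommRing R] (p e : ℕ)

instance : CommRing (FrobeniusPushforward R p e) := inferInstanceAs (CommRing R)

/-- The identity map onto the Frobenius pushforward. -/
def of : R ≃+* FrobeniusPushforward R p e := RingEquiv.refl R

instance [ExpChar R p] : Algebra R (FrobeniusPushforward R p e) :=
  ((of R p e : R →+* FrobeniusPushforward R p e).comp (iterateFrobenius R p e)).toAlgebra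

theorem algebraMap_apply [ExpChar R p] (r : R) :
    algebraMap R (FrobeniusPushforward R p e) r = of R p e (r ^ p ^ e) := rfl

theorem map_algebraMap [ExpChar R p] (J : Ideal R) :
    J.map (algebraMap R (FrobeniusPushforward R p e)) =
      (frobeniusPower J (p ^ e)).map (of R p e) := by
  rw [frobeniusPower, Ideal.map_span, ← Set.image_comp]
  rfl

theorem of_mem_map_algebraMap [ExpChar R p] {J : Ideal R} {x : R} :
    of R p e x ∈ J.map (algebraMap R (FrobeniusPushforward R p e)) ↔
      x ∈ frobeniusPower J (p ^ e) := by
  rw [map_algebraMap]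
  refine ⟨fun h => ?_, fun h => Ideal.mem_map_of_mem _ h⟩
  obtain ⟨y, hy, hxy⟩ := (Ideal.mem_map_iff_of_surjective _ (of R p e).surjective).1 h
  rwa [← (of R p e).injective hxy]

end FrobeniusPushforward

theorem frobenius_finite {R : Type*} [CommRing R] {p : ℕ} [ExpChar R p] (h : FFinite R p) :
    (frobenius R p).Finite := by
  have hmem : ∀ x : R, frobenius R p x ∈ pthPowers R p :=
    fun x => Subring.subset_closure ⟨x, rfl⟩
  have hsurj : Function.Surjective ((frobenius R p).codRestrict (pthPowers R p) hmem) := by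
    rintro ⟨y, hy⟩
    have hle : pthPowers R p ≤ (frobenius R p).range :=
      Subring.closure_le.2 (by rintro _ ⟨x, rfl⟩; exact ⟨x, rfl⟩)
    obtain ⟨x, rfl⟩ := hle hy
    exact ⟨x, rfl⟩
  have h2 : ((pthPowers R p).subtype).Finite := by
    rw [FFinite] at h
    exact RingHom.finite_algebraMap.2 h
  exact h2.comp (RingHom.Finite.of_surjective _ hsurj)

theorem iterateFrobenius_finite {R : Type*} [CommRing R] {p : ℕ} [ExpChar R p]
    (h : FFinite R p) (e : ℕ) : (iterateFrobenius R p e).Finite := by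
  induction e with
  | zero =>
    rw [iterateFrobenius_zero]
    exact RingHom.Finite.id R
  | succ e ih =>
    have : iterateFrobenius R p (e + 1) = (frobenius R p).comp (iterateFrobenius R p e) := by
      ext x
      simp [iterateFrobenius_def, frobenius_def, pow_succ, pow_mul]
    rw [this]
    exact (frobenius_finite h).comp ih

theorem finite_frobeniusPushforward {R : Type*} [CommRing R] {p : ℕ} [ExpChar R p]
    (h : FFinite R p) (e : ℕ) : Module.Finite R (FrobeniusPushforward R p e) := by
  rw [← RingHom.finite_algebraMap]
  exact (RingHom.Finite.of_surjective _ (FrobeniusPushforward.of R p e).surjective).comp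
    (iterateFrobenius_finite h e)

theorem exists_ofList_eq_maximalIdeal {R : Type*} [CommRing R] [IsLocalRing R]
    (h : IsRegularLocal R) :
    ∃ rs : List R, Ideal.ofList rs = maximalIdeal R ∧ ringKrullDim R = rs.length := by
  obtain ⟨-, s, hs, hdim⟩ := h
  refine ⟨s.toList, ?_, ?_⟩
  · rw [← hs, Ideal.ofList]
    simp
  · simp [← hdim]

theorem frobeniusPower_ofList {R : Type*} [CommRing R] {p : ℕ} [ExpChar R p] (e : ℕ)
    (rs : List R) :
    frobeniusPower (Ideal.ofList rs) (p ^ e) = Ideal.ofList (rs.map (· ^ p ^ e)) :=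
  Ideal.map_ofList (iterateFrobenius R p e) rs

/-- Kunz's theorem: the Frobenius of an F-finite regular local ring is free. -/
theorem free_frobeniusPushforward {R : Type*} [CommRing R] [IsLocalRing R] {p : ℕ} [ExpChar R p]
    (hreg : IsRegularLocal R) (hFF : FFinite R p) (e : ℕ) :
    Module.Free R (FrobeniusPushforward R p e) := by
  have := hreg.1
  have := finite_frobeniusPushforward hFF e
  obtain ⟨rs, hrs, hdim⟩ := exists_ofList_eq_maximalIdeal hreg
  refine free_of_isWeaklyRegular _ rs hrs ?_
  have hmem : ∀ r ∈ rs ++ [], r ∈ maximalIdeal R := fun r hr => by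
    rw [← hrs]
    exact Ideal.subset_span (by simpa using hr)
  have h1 := isWeaklyRegular_map_pow_append (n := p ^ e) (expChar_pow_pos R p e).ne' rs []
    hmem (by simpa using isWeaklyRegular_of_ofList_eq_maximalIdeal rs hrs hdim)
  rw [List.append_nil] at h1
  refine (AddEquiv.isWeaklyRegular_congr
    (e := (FrobeniusPushforward.of R p e).toAddEquiv) ?_).1 h1
  rw [List.forall₂_map_left_iff, List.forall₂_same]
  intro r _ x
  rw [smul_eq_mul, Algebra.smul_def, FrobeniusPushforward.algebraMap_apply]
  exact map_mul (FrobeniusPushforward.of R p e) _ _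

theorem exists_dualizing_form_frobeniusPushforward {R : Type*} [CommRing R] [IsLocalRing R]
    {p : ℕ} [ExpChar R p] (hreg : IsRegularLocal R) (hFF : FFinite R p) (e : ℕ) :
    ∃ Φ : FrobeniusPushforward R p e →ₗ[R] R,
      ∀ φ : FrobeniusPushforward R p e →ₗ[R] R, ∃ f, ∀ x, φ x = Φ (f * x) := by
  have := hreg.1
  have := finite_frobeniusPushforward hFF e
  have := free_frobeniusPushforward hreg hFF e
  obtain ⟨rs, hrs, hdim⟩ := exists_ofList_eq_maximalIdeal hreg
  obtain ⟨n, hn⟩ := Nat.exists_eq_succ_of_ne_zero (expChar_pow_pos R p e).ne'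
  have hmem : ∀ r ∈ rs ++ [], r ∈ maximalIdeal R := fun r hr => by
    rw [← hrs]
    exact Ideal.subset_span (by simpa using hr)
  have hpow : Ideal.ofList (rs.map (· ^ (n + 1)) ++ []) =
      frobeniusPower (maximalIdeal R) (p ^ e) := by
    rw [List.append_nil, ← hrs, frobeniusPower_ofList, hn]
  have hnot := prod_pow_notMem n rs [] hmem
    (by simpa using isWeaklyRegular_of_ofList_eq_maximalIdeal rs hrs hdim)
  have hsoc := isSocleGenerator_prod_pow n rs []
    (by simpa [hrs] using isSocleGenerator_maximalIdeal R)
  rw [hpow] at hnot hsoc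
  refine exists_dualizing_form (FrobeniusPushforward.of R p e (rs.map (· ^ n)).prod)
    (fun h => hnot (FrobeniusPushforward.of_mem_map_algebraMap R p e |>.1 h)) ?_
  intro z hz
  obtain ⟨z, rfl⟩ := (FrobeniusPushforward.of R p e).surjective z
  obtain ⟨y, hy⟩ := hsoc z fun h => hz (FrobeniusPushforward.of_mem_map_algebraMap R p e |>.2 h)
  refine ⟨FrobeniusPushforward.of R p e y, ?_⟩
  rw [← map_mul, ← map_sub]
  exact (FrobeniusPushforward.of_mem_map_algebraMap R p e).2 hy

/-- The linear form on the Frobenius pushforward given by a `p ^ e`-inverse linear map. -/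
def linearFormOfAddHom {R : Type*} [CommRing R] {p : ℕ} [ExpChar R p] (e : ℕ) {M : Type*}
    [AddCommGroup M] [Module R M] (φ : R →+ M) (hφ : ∀ a x : R, φ (a ^ p ^ e * x) = a • φ x) :
    FrobeniusPushforward R p e →ₗ[R] M where
  toFun x := φ ((FrobeniusPushforward.of R p e).symm x)
  map_add' x y := by simp
  map_smul' a x := by
    rw [Algebra.smul_def, FrobeniusPushforward.algebraMap_apply, map_mul,
      RingEquiv.symm_apply_apply, hφ, RingHom.id_apply]

theorem exists_colon_of_splitsAlong {R : Type*} [CommRing R] [IsLocalRing R] {p : ℕ}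
    [ExpChar R p] (hreg : IsRegularLocal R) (hFF : FFinite R p) {I : Ideal R} (hI : I ≠ ⊤)
    {e : ℕ} {d : R} (h : SplitsAlong (R ⧸ I) (Ideal.Quotient.mk I d) (p ^ e)) :
    ∃ f ∈ Submodule.colon (frobeniusPower I (p ^ e)) (I : Set R),
      d * f ∉ frobeniusPower (maximalIdeal R) (p ^ e) := by
  have := finite_frobeniusPushforward hFF e
  have := free_frobeniusPushforward hreg hFF e
  obtain ⟨φ, hφ, hφd⟩ := h
  obtain ⟨Φ, hΦ⟩ := exists_dualizing_form_frobeniusPushforward hreg hFF e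
  let F := FrobeniusPushforward.of R p e
  let g : FrobeniusPushforward R p e →ₗ[R] R ⧸ I :=
    linearFormOfAddHom e (φ.comp (Ideal.Quotient.mk I : R →+ R ⧸ I)) fun a x => by
      simpa [Algebra.smul_def] using! hφ (Ideal.Quotient.mk I a) (Ideal.Quotient.mk I x)
  obtain ⟨ψ, hψ⟩ := Module.projective_lifting_property I.mkQ g I.mkQ_surjective
  have hψ' : ∀ x, Ideal.Quotient.mk I (ψ (F x)) = φ (Ideal.Quotient.mk I x) :=
    fun x => LinearMap.congr_fun hψ (F x)
  have hψI : ∀ x ∈ I, ∀ y, ψ (F x * y) ∈ I := by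
    intro x hx y
    obtain ⟨y, rfl⟩ := F.surjective y
    rw [← map_mul, ← Ideal.Quotient.eq_zero_iff_mem, hψ',
      Ideal.Quotient.eq_zero_iff_mem.2 (I.mul_mem_right y hx), map_zero]
  obtain ⟨f, hf⟩ := hΦ ψ
  obtain ⟨f, rfl⟩ := F.surjective f
  refine ⟨f, Submodule.mem_colon.2 fun x hx => ?_, fun hdf => ?_⟩
  · rw [smul_eq_mul, ← FrobeniusPushforward.of_mem_map_algebraMap]
    refine mem_map_of_forall_apply_mem fun θ => ?_
    obtain ⟨c, hc⟩ := hΦ θ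
    have := hψI x hx c
    rwa [hf, ← mul_assoc, mul_comm, ← map_mul, ← hc] at this
  · rw [mul_comm, ← FrobeniusPushforward.of_mem_map_algebraMap] at hdf
    have h1 := apply_mem_of_mem_map Φ hdf
    rw [map_mul, ← hf] at h1
    have h2 : ψ (F d) - 1 ∈ I := by
      rw [← Ideal.Quotient.eq_zero_iff_mem, map_sub, hψ', hφd, map_one, sub_self]
    have h3 : (1 : R) ∈ maximalIdeal R := by simpa [F] using sub_mem h1 (le_maximalIdeal hI h2)
    exact (Ideal.ne_top_iff_one _).1 (maximalIdeal.isMaximal R).ne_top h3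

theorem splitsAlong_of_notMem {R : Type*} [CommRing R] [IsLocalRing R] {p : ℕ}
    [ExpChar R p] (hreg : IsRegularLocal R) (hFF : FFinite R p) {I : Ideal R}
    {e : ℕ} {d f : R} (hf : f ∈ Submodule.colon (frobeniusPower I (p ^ e)) (I : Set R))
    (hdf : d * f ∉ frobeniusPower (maximalIdeal R) (p ^ e)) :
    SplitsAlong (R ⧸ I) (Ideal.Quotient.mk I d) (p ^ e) := by
  have := finite_frobeniusPushforward hFF e
  have := free_frobeniusPushforward hreg hFF e
  let F := FrobeniusPushforward.of R p e
  rw [← FrobeniusPushforward.of_mem_map_algebraMap] at hdf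
  obtain ⟨θ, hθ⟩ := exists_apply_eq_one hdf
  let ψ : R →+ R := θ.toAddMonoidHom.comp
    ((F : R →+ FrobeniusPushforward R p e).comp (AddMonoidHom.mulRight f))
  have hψ : ∀ x, ψ x = θ (F (x * f)) := fun x => rfl
  have hψI : I.toAddSubgroup ≤ I.toAddSubgroup.comap ψ := by
    intro x hx
    refine apply_mem_of_mem_map θ ((FrobeniusPushforward.of_mem_map_algebraMap R p e).2 ?_)
    rw [AddMonoidHom.mulRight_apply, mul_comm]
    exact Submodule.mem_colon.1 hf x hx
  let Ψ : R ⧸ I →+ R ⧸ I := QuotientAddGroup.map _ _ ψ hψI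
  have hΨ : ∀ x, Ψ (Ideal.Quotient.mk I x) = Ideal.Quotient.mk I (ψ x) := fun x => rfl
  refine ⟨Ψ, fun a x => ?_, ?_⟩
  · obtain ⟨a, rfl⟩ := Ideal.Quotient.mk_surjective a
    obtain ⟨x, rfl⟩ := Ideal.Quotient.mk_surjective x
    rw [← map_pow, ← map_mul, hΨ, hΨ, ← map_mul, hψ, hψ, mul_assoc, map_mul F,
      ← FrobeniusPushforward.algebraMap_apply, ← Algebra.smul_def, map_smul, smul_eq_mul]
  · rw [hΨ, hψ, hθ, map_one]

theorem prod_pow_map {R S : Type*} [CommRing R] [CommRing S] (g : R →+* S) {k : ℕ}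
    (a : Fin k → Ideal R) (n : Fin k → ℕ) :
    ∏ i, (a i).map g ^ n i = (∏ i, a i ^ n i).map g := by
  simp only [← Ideal.map_pow]
  exact (map_prod (Ideal.mapHom g) _ _).symm

end Fedder

/-- Fedder type criterion for F-purity of the pair
`(R/I, (a₁S)^{t₁} ⋯ (a_kS)^{t_k})`. -/
theorem fedder_fPure {R : Type*} [CommRing R] [IsLocalRing R] (p : ℕ)
    [Fact p.Prime] [CharP R p] (hreg : IsRegularLocal R) (hFF : FFinite R p)
    (I : Ideal R) (hIrad : I.IsRadical) (hIne : I ≠ ⊤) {k : ℕ}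
    (a : Fin k → Ideal R) (t : Fin k → ℝ) (ht : ∀ i, 0 < t i) :
    FPurePair (R ⧸ I) p (fun i => (a i).map (Ideal.Quotient.mk I)) t ↔
      ∃ e₀ : ℕ, ∀ e : ℕ, e₀ ≤ e →
        ¬ ((∏ i, a i ^ ⌊t i * ((p ^ e : ℝ) - 1)⌋₊) *
              Submodule.colon (frobeniusPower I (p ^ e)) I ≤
            frobeniusPower (IsLocalRing.maximalIdeal R) (p ^ e)) := by
  have := hreg.1
  refine exists_congr fun e₀ => forall₂_congr fun e _ => ?_
  rw [Fedder.prod_pow_map, Ideal.mul_le]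
  push Not
  constructor
  · rintro ⟨_, hd, h⟩
    obtain ⟨d, hd', rfl⟩ :=
      (Ideal.mem_map_iff_of_surjective _ Ideal.Quotient.mk_surjective).1 hd
    exact ⟨d, hd', Fedder.exists_colon_of_splitsAlong hreg hFF hIne h⟩
  · rintro ⟨d, hd, f, hf, hdf⟩
    exact ⟨_, Ideal.mem_map_of_mem _ hd, Fedder.splitsAlong_of_notMem hreg hFF hf hdf⟩
end

section
/- (Fedder type criterion for pure F-regularity.) Let (R, m) be an F-finite regular local ring of prime characteristic p > 0 and I ⊊ R a reduced ideal. Let a₁,…,a_k be ideals of R, t₁,…,t_k > 0 real numbers, and write S = R/I. Then the pair (S, (a₁S)^{t₁}⋯(a_kS)^{t_k}) is purely F-regular if and only if for every element c ∈ R ∖ I which is not contained in any minimal prime ideal of a₁⋯a_k + I, there exists a power q₀ of p such that for every q = p^e ≥ q₀ one has c · a₁^{⌊t₁(q−1)⌋}⋯a_k^{⌊t_k(q−1)⌋} · (I^{[q]} : I) ⊄ m^{[q]}. -/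
universe u

/-- A tuple of `n` generators of the maximal ideal of a local ring of dimension at least `n`. -/
structure IsRegularSystem {R : Type*} [CommRing R] [IsLocalRing R] {n : ℕ} (x : Fin n → R) :
    Prop where
  span_range : Ideal.span (Set.range x) = IsLocalRing.maximalIdeal R
  le_dim : (n : WithBot ℕ∞) ≤ ringKrullDim R

lemma ringKrullDim_le_of_span_range_eq_maximalIdeal {R : Type*} [CommRing R] [IsLocalRing R]
    [IsNoetherianRing R] {n : ℕ} {x : Fin n → R}
    (hx : Ideal.span (Set.range x) = IsLocalRing.maximalIdeal R) : ringKrullDim R ≤ n := by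
  refine (ringKrullDim_le_spanFinrank_maximalIdeal R).trans ?_
  rw [← hx]
  have h := (Submodule.spanFinrank_span_le_ncard_of_finite (R := R) (Set.finite_range x)).trans
    ((Set.ncard_image_le (Set.finite_univ (α := Fin n)) (f := x)).trans_eq' (by simp))
  exact_mod_cast h.trans (by simp)

lemma ringKrullDim_le_ringKrullDim_quotient_span_singleton_add_one {R : Type*} [CommRing R]
    [IsLocalRing R] [IsNoetherianRing R] {y : R} (hy : y ∈ IsLocalRing.maximalIdeal R) :
    ringKrullDim R ≤ ringKrullDim (R ⧸ Ideal.span {y}) + 1 := by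
  simpa using ringKrullDim_le_ringKrullDim_quotient_add_encard {y}
    (by simpa [IsLocalRing.ringJacobson_eq_maximalIdeal] using hy)

namespace IsRegularSystem

variable {R : Type*} [CommRing R] [IsLocalRing R] {n : ℕ}

lemma mem_maximalIdeal {x : Fin n → R} (hx : IsRegularSystem x) (i : Fin n) :
    x i ∈ IsLocalRing.maximalIdeal R :=
  hx.span_range ▸ Ideal.subset_span ⟨i, rfl⟩

lemma span_singleton_ne_top {x : Fin n → R} (hx : IsRegularSystem x) (i : Fin n) :
    Ideal.span {x i} ≠ ⊤ := fun h =>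
  (IsLocalRing.maximalIdeal.isMaximal R).ne_top
    (top_le_iff.mp (h ▸ (Ideal.span_singleton_le_iff_mem _).mpr (hx.mem_maximalIdeal i)))

lemma span_range_map_tail {x : Fin (n + 1) → R}
    (hx : Ideal.span (Set.range x) = IsLocalRing.maximalIdeal R) {S : Type*} [CommRing S]
    [IsLocalRing S] (f : R →+* S) (hf : Function.Surjective f) (h0 : f (x 0) = 0) :
    Ideal.span (Set.range fun i => f (x (Fin.succ i))) = IsLocalRing.maximalIdeal S := by
  rw [← IsLocalRing.map_maximalIdeal_of_surjective f hf, ← hx, Ideal.map_span]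
  apply le_antisymm
  · apply Ideal.span_mono
    rintro _ ⟨i, rfl⟩
    exact ⟨_, ⟨_, rfl⟩, rfl⟩
  · rw [Ideal.span_le]
    rintro _ ⟨_, ⟨i, rfl⟩, rfl⟩
    refine Fin.cases ?_ (fun j => ?_) i
    · simp [h0]
    · exact Ideal.subset_span ⟨j, rfl⟩

lemma quotient [IsNoetherianRing R] {x : Fin (n + 1) → R} (hx : IsRegularSystem x)
    [IsLocalRing (R ⧸ Ideal.span {x 0})] :
    IsRegularSystem fun i => Ideal.Quotient.mk (Ideal.span {x 0}) (x (Fin.succ i)) where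
  span_range := span_range_map_tail hx.span_range _ Ideal.Quotient.mk_surjective
    (Ideal.Quotient.eq_zero_iff_mem.mpr (Ideal.mem_span_singleton_self _))
  le_dim := by
    have h := hx.le_dim.trans
      (ringKrullDim_le_ringKrullDim_quotient_span_singleton_add_one (hx.mem_maximalIdeal 0))
    push_cast at h
    exact ENat.WithBot.add_le_add_one_right_iff.mp h

end IsRegularSystem

lemma exists_prime_le_ringKrullDim_quotient {R : Type*} [CommRing R] {n : ℕ}
    (hn : (n : WithBot ℕ∞) ≤ ringKrullDim R) :
    ∃ P : Ideal R, P.IsPrime ∧ (n : WithBot ℕ∞) ≤ ringKrullDim (R ⧸ P) := by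
  obtain ⟨l, hl⟩ := Order.le_krullDim_iff.mp hn
  refine ⟨l.head.asIdeal, l.head.isPrime, ?_⟩
  rw [ringKrullDim_quotient, Order.le_krullDim_iff]
  exact ⟨⟨l.length, fun i => ⟨l i, l.head_le i⟩, fun i => l.step i⟩, hl⟩

lemma isLocalRing_quotient {R : Type*} [CommRing R] [IsLocalRing R] {I : Ideal R} (hI : I ≠ ⊤) :
    IsLocalRing (R ⧸ I) :=
  have := Ideal.Quotient.nontrivial_iff.mpr hI
  IsLocalRing.of_surjective' _ Ideal.Quotient.mk_surjective

/-- A regular local ring is a domain. -/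
theorem IsRegularSystem.isDomain {n : ℕ} {R : Type u} [CommRing R] [IsLocalRing R]
    [IsNoetherianRing R] {x : Fin n → R} (hx : IsRegularSystem x) : IsDomain R := by
  induction n generalizing R with
  | zero =>
    have h : IsLocalRing.maximalIdeal R = ⊥ := by
      rw [← hx.span_range, Set.range_eq_empty, Ideal.span_empty]
    exact (IsLocalRing.isField_iff_maximalIdeal_eq.mpr h).isDomain
  | succ n ih =>
    have := isLocalRing_quotient (hx.span_singleton_ne_top 0)
    have hdom : IsDomain (R ⧸ Ideal.span {x 0}) := ih hx.quotient
    have hdim := ringKrullDim_le_of_span_range_eq_maximalIdeal hx.quotient.span_range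
    obtain ⟨P, hP, hnP⟩ := exists_prime_le_ringKrullDim_quotient hx.le_dim
    have := isLocalRing_quotient hP.ne_top
    have hxP : x 0 ∉ P := fun h => by
      have := hnP.trans (ringKrullDim_le_of_span_range_eq_maximalIdeal
        (span_range_map_tail hx.span_range (Ideal.Quotient.mk P) Ideal.Quotient.mk_surjective
          (Ideal.Quotient.eq_zero_iff_mem.mpr h)))
      norm_cast at this
      omega
    have hPx : P ≤ Ideal.span {x 0} := by
      intro y hy
      by_contra hyx
      have h1 := ringKrullDim_quotient_succ_le_of_nonZeroDivisor
        (mem_nonZeroDivisors_of_ne_zero fun h0 : Ideal.Quotient.mk (Ideal.span {x 0}) y = 0 =>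
          hyx (Ideal.Quotient.eq_zero_iff_mem.mp h0))
      have h2 := hnP.trans (ringKrullDim_le_ringKrullDim_quotient_span_singleton_add_one
        (y := Ideal.Quotient.mk P (x 0)) (by
          rw [← IsLocalRing.map_maximalIdeal_of_surjective _ Ideal.Quotient.mk_surjective]
          exact Ideal.mem_map_of_mem _ (hx.mem_maximalIdeal 0)))
      let f : R →+* (R ⧸ P) ⧸ Ideal.span {Ideal.Quotient.mk P (x 0)} :=
        (Ideal.Quotient.mk _).comp (Ideal.Quotient.mk P)
      have hf : Function.Surjective f :=
        Ideal.Quotient.mk_surjective.comp Ideal.Quotient.mk_surjective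
      let g := Ideal.Quotient.lift (Ideal.span {x 0}) f (fun a ha => by
        obtain ⟨b, rfl⟩ := Ideal.mem_span_singleton'.mp ha
        rw [RingHom.comp_apply, map_mul]
        exact Ideal.Quotient.eq_zero_iff_mem.mpr
          (Ideal.mul_mem_left _ _ (Ideal.mem_span_singleton_self _)))
      have hg : Function.Surjective g := Ideal.Quotient.lift_surjective_of_surjective _ _ hf
      have h3 := ringKrullDim_le_of_surjective
        (Ideal.Quotient.lift (Ideal.span {Ideal.Quotient.mk (Ideal.span {x 0}) y}) g (fun a ha => by
          obtain ⟨b, rfl⟩ := Ideal.mem_span_singleton'.mp ha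
          have : g (Ideal.Quotient.mk _ y) = 0 := by
            simp [g, f, Ideal.Quotient.eq_zero_iff_mem.mpr hy]
          rw [map_mul, this, mul_zero]))
        (Ideal.Quotient.lift_surjective_of_surjective _ _ hg)
      have h4 : ((n + 1 : ℕ) : WithBot ℕ∞) ≤ n :=
        h2.trans (((by gcongr : _ ≤ _).trans h1).trans hdim)
      norm_cast at h4
      omega
    have hbot : P = ⊥ := by
      refine Submodule.eq_bot_of_le_smul_of_le_jacobson_bot (Ideal.span {x 0}) P
        (IsNoetherian.noetherian P) (fun y hy => ?_) ?_
      · obtain ⟨b, rfl⟩ := Ideal.mem_span_singleton'.mp (hPx hy)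
        rw [mul_comm, ← smul_eq_mul]
        exact Submodule.smul_mem_smul (Ideal.mem_span_singleton_self _)
          ((hP.mem_or_mem hy).resolve_right hxP)
      · rw [IsLocalRing.jacobson_eq_maximalIdeal _ bot_ne_top, Ideal.span_singleton_le_iff_mem]
        exact hx.mem_maximalIdeal 0
    subst hbot
    exact IsDomain.of_bot_isPrime R

lemma IsRegularSystem.ne_zero {n : ℕ} {R : Type*} [CommRing R] [IsLocalRing R]
    [IsNoetherianRing R] {x : Fin (n + 1) → R} (hx : IsRegularSystem x) : x 0 ≠ 0 := fun h => by
  have := hx.le_dim.trans (ringKrullDim_le_of_span_range_eq_maximalIdeal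
    (span_range_map_tail hx.span_range (RingHom.id R) Function.surjective_id h))
  norm_cast at this
  omega

/-- A copy of `R`, regarded as an `R`-module through the `e`-th iterate of Frobenius. -/
def FrobeniusModule (R : Type*) (_p _e : ℕ) : Type _ := R

namespace FrobeniusModule

variable (R : Type*) [CommRing R] (p e : ℕ)

instance : CommRing (FrobeniusModule R p e) := inferInstanceAs (CommRing R)

instance [Nontrivial R] : Nontrivial (FrobeniusModule R p e) := inferInstanceAs (Nontrivial R)

/-- The identity map from `R` to its Frobenius pushforward. -/
def of : R ≃+* FrobeniusModule R p e := RingEquiv.refl R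

variable [ExpChar R p]

instance : Algebra R (FrobeniusModule R p e) :=
  ((of R p e).toRingHom.comp (iterateFrobenius R p e)).toAlgebra

variable {R p e}

lemma smul_of (a r : R) : a • of R p e r = of R p e (a ^ p ^ e * r) := by
  rw [Algebra.smul_def, map_mul]
  rfl

lemma finite (h : (iterateFrobenius R p e).Finite) : Module.Finite R (FrobeniusModule R p e) :=
  h

end FrobeniusModule

/-- A finite family `v` such that every element of `R` is uniquely of the form `∑ i, a i ^ q * v i`:
a basis of `R` over its subring of `q`-th powers, when `R` is a reduced ring and `q` a power of its
characteristic. -/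
def IsFrobeniusBasis {R ι : Type*} [CommRing R] [Fintype ι] (q : ℕ) (v : ι → R) : Prop :=
  Function.Bijective fun a : ι → R => ∑ i, a i ^ q * v i

lemma isFrobeniusBasis_of_basis {R ι : Type*} [CommRing R] [Fintype ι] {p e : ℕ} [ExpChar R p]
    (b : Module.Basis ι R (FrobeniusModule R p e)) :
    IsFrobeniusBasis (p ^ e) fun i => (FrobeniusModule.of R p e).symm (b i) := by
  refine (congrArg Function.Bijective (funext fun a => ?_)).mpr
    ((FrobeniusModule.of R p e).symm.bijective.comp b.equivFun.symm.bijective)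
  rw [Function.comp_apply, Module.Basis.equivFun_symm_apply, map_sum]
  refine Finset.sum_congr rfl fun i _ => ?_
  obtain ⟨r, hr⟩ := (FrobeniusModule.of R p e).surjective (b i)
  beta_reduce
  rw [← hr, FrobeniusModule.smul_of, RingEquiv.symm_apply_apply, RingEquiv.symm_apply_apply]

lemma exists_isFrobeniusBasis_of_isField {R : Type u} [CommRing R] {p e : ℕ} [ExpChar R p]
    (hR : IsField R) (hfin : (iterateFrobenius R p e).Finite) :
    ∃ (ι : Type u) (_ : Fintype ι) (v : ι → R) (i : ι), IsFrobeniusBasis (p ^ e) v ∧ v i = 1 := by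
  let := hR.toField
  have := FrobeniusModule.finite hfin
  have hli : LinearIndepOn R id {FrobeniusModule.of R p e 1} := by
    refine LinearIndepOn.singleton ?_
    simp
  let b := Module.Basis.extend hli
  have := Module.Finite.finite_basis b
  refine ⟨_, Fintype.ofFinite _, _, ⟨FrobeniusModule.of R p e 1, ?_⟩,
    @isFrobeniusBasis_of_basis _ _ _ (Fintype.ofFinite _) _ _ _ b, ?_⟩
  · rw [Module.Basis.extend_apply_self, RingEquiv.symm_apply_apply]
  · exact hli.subset_extend _ rfl

section Deformation

variable {R ι : Type*} [CommRing R] [Fintype ι] {p e : ℕ} {x : R} {v : ι → R}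

lemma dvd_of_sum_pow_mul_eq_zero [IsDomain R] (hx0 : x ≠ 0)
    (hv : IsFrobeniusBasis (p ^ e) fun i => Ideal.Quotient.mk (Ideal.span {x}) (v i))
    {a : ι × Fin (p ^ e) → R} (ha : ∑ i, a i ^ p ^ e * (x ^ (i.2 : ℕ) * v i.1) = 0)
    (i : ι × Fin (p ^ e)) : x ∣ a i := by
  suffices ∀ (j : ℕ) (hj : j < p ^ e) (i : ι), x ∣ a (i, ⟨j, hj⟩) from this i.2 i.2.2 i.1
  intro j
  induction j using Nat.strong_induction_on with
  | _ j ih =>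
    intro hj
    rw [Fintype.sum_prod_type_right, ← Finset.add_sum_erase _ _ (Finset.mem_univ ⟨j, hj⟩)] at ha
    have hdvd : x ^ (j + 1) ∣ ∑ j' ∈ Finset.univ.erase ⟨j, hj⟩,
        ∑ i, a (i, j') ^ p ^ e * (x ^ (j' : ℕ) * v i) := by
      refine Finset.dvd_sum fun j' hj' => Finset.dvd_sum fun i _ => ?_
      have hne : (j' : ℕ) ≠ j := fun h => (Finset.mem_erase.mp hj').1 (Fin.ext h)
      rcases lt_or_gt_of_ne hne with h | h
      · exact (((pow_dvd_pow x hj).trans (pow_dvd_pow_of_dvd (ih j' h j'.2 i) _))).mul_right _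
      · exact (pow_dvd_pow x h).trans ((dvd_mul_right _ _).mul_left _)
    have hj0 : x ^ j * x ∣ x ^ j * ∑ i, a (i, ⟨j, hj⟩) ^ p ^ e * v i := by
      rw [← pow_succ, Finset.mul_sum]
      simp_rw [mul_left_comm (x ^ j)]
      exact (dvd_add_left hdvd).mp (ha ▸ dvd_zero _)
    have hmod : ∑ i, Ideal.Quotient.mk (Ideal.span {x}) (a (i, ⟨j, hj⟩)) ^ p ^ e *
        Ideal.Quotient.mk (Ideal.span {x}) (v i) = 0 := by
      simp_rw [← map_pow, ← map_mul, ← map_sum]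
      exact Ideal.Quotient.eq_zero_iff_mem.mpr (Ideal.mem_span_singleton.mpr
        ((mul_dvd_mul_iff_left (pow_ne_zero _ hx0)).mp hj0))
    have h0 := @hv.1 (fun i => Ideal.Quotient.mk (Ideal.span {x}) (a (i, ⟨j, hj⟩))) 0 (by
      simpa [zero_pow (by omega : p ^ e ≠ 0)] using hmod)
    exact fun i => Ideal.mem_span_singleton.mp (Ideal.Quotient.eq_zero_iff_mem.mp (congrFun h0 i))

lemma exists_eq_sum_add_mul
    (hv : IsFrobeniusBasis (p ^ e) fun i => Ideal.Quotient.mk (Ideal.span {x}) (v i)) (r : R) :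
    ∃ (a : ι → R) (r' : R), r = ∑ i, a i ^ p ^ e * v i + x * r' := by
  obtain ⟨a, ha⟩ := hv.2 (Ideal.Quotient.mk _ r)
  choose b hb using fun i => Ideal.Quotient.mk_surjective (a i)
  simp_rw [← hb, ← map_pow, ← map_mul, ← map_sum] at ha
  obtain ⟨c, hc⟩ := Ideal.mem_span_singleton.mp (Ideal.Quotient.eq.mp ha.symm)
  exact ⟨b, c, by rw [← hc]; ring⟩

/-- A Frobenius basis of `R ⧸ (x)` lifts to the Frobenius basis `x ^ j * v i`, `0 ≤ j < q`, of
`R`. -/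
lemma IsFrobeniusBasis.deform [IsLocalRing R] [IsNoetherianRing R] [IsDomain R] [ExpChar R p]
    (hfin : (iterateFrobenius R p e).Finite)
    (hxm : x ∈ IsLocalRing.maximalIdeal R) (hx0 : x ≠ 0)
    (hv : IsFrobeniusBasis (p ^ e) fun i => Ideal.Quotient.mk (Ideal.span {x}) (v i)) :
    IsFrobeniusBasis (p ^ e) fun i : ι × Fin (p ^ e) => x ^ (i.2 : ℕ) * v i.1 := by
  have := FrobeniusModule.finite hfin
  have hjac : Ideal.span {x} ≤ (⊥ : Ideal R).jacobson := by
    rwa [IsLocalRing.jacobson_eq_maximalIdeal _ bot_ne_top, Ideal.span_singleton_le_iff_mem]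
  let w : ι × Fin (p ^ e) → FrobeniusModule R p e := fun i =>
    FrobeniusModule.of R p e (x ^ (i.2 : ℕ) * v i.1)
  have hw (a : ι × Fin (p ^ e) → R) : ∑ i, a i • w i =
      FrobeniusModule.of R p e (∑ i, a i ^ p ^ e * (x ^ (i.2 : ℕ) * v i.1)) := by
    simp_rw [w, FrobeniusModule.smul_of, map_sum]
  have hspan : ⊤ ≤ Submodule.span R (Set.range w) := by
    refine Submodule.le_of_le_smul_of_le_jacobson_bot Module.Finite.fg_top hjac fun r _ => ?_
    have key : ∀ k ≤ p ^ e, ∀ r : R, ∃ z ∈ Submodule.span R (Set.range w), ∃ r' : R,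
        FrobeniusModule.of R p e r = z + FrobeniusModule.of R p e (x ^ k * r') := by
      intro k
      induction k with
      | zero => exact fun _ r => ⟨0, zero_mem _, r, by simp⟩
      | succ k ih =>
        intro hk r
        obtain ⟨z, hz, r', hr⟩ := ih (Nat.le_of_succ_le hk) r
        obtain ⟨a, r'', hr'⟩ := exists_eq_sum_add_mul hv r'
        refine ⟨z + ∑ i, a i • w (i, ⟨k, hk⟩), add_mem hz (sum_mem fun i _ =>
          Submodule.smul_mem _ _ (Submodule.subset_span ⟨_, rfl⟩)), r'', ?_⟩
        rw [hr, hr', add_assoc]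
        simp_rw [w, FrobeniusModule.smul_of, ← map_sum, ← map_add, mul_left_comm _ (x ^ k),
          ← Finset.mul_sum]
        congr 2
        ring
    obtain ⟨s, rfl⟩ := (FrobeniusModule.of R p e).surjective r
    obtain ⟨z, hz, s', hs⟩ := key _ le_rfl s
    rw [hs, ← FrobeniusModule.smul_of]
    exact add_mem (Submodule.mem_sup_left hz) (Submodule.mem_sup_right
      (Submodule.smul_mem_smul (Ideal.mem_span_singleton_self _) trivial))
  have hker : LinearMap.ker (Fintype.linearCombination R w) = ⊥ := by
    refine Submodule.eq_bot_of_le_smul_of_le_jacobson_bot (Ideal.span {x}) _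
      (IsNoetherian.noetherian _) (fun a ha => ?_) hjac
    rw [LinearMap.mem_ker, Fintype.linearCombination_apply, hw, map_eq_zero_iff _
      (FrobeniusModule.of R p e).injective] at ha
    choose b hb using dvd_of_sum_pow_mul_eq_zero hx0 hv ha
    have hab : a = x • b := funext hb
    rw [hab]
    refine Submodule.smul_mem_smul (Ideal.mem_span_singleton_self _) ?_
    rw [LinearMap.mem_ker, Fintype.linearCombination_apply, hw, map_eq_zero_iff _
      (FrobeniusModule.of R p e).injective]
    simp_rw [hb, mul_pow, mul_assoc, ← Finset.mul_sum] at ha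
    exact (mul_eq_zero.mp ha).resolve_left (pow_ne_zero _ hx0)
  have hli : LinearIndependent R w := by
    rwa [linearIndependent_iff_injective_fintypeLinearCombination, ← LinearMap.ker_eq_bot]
  convert isFrobeniusBasis_of_basis (Module.Basis.mk hli hspan) using 1
  ext i
  simp [w]

end Deformation

lemma charP_quotient {R : Type*} [CommRing R] {p : ℕ} [Fact p.Prime] [CharP R p] {I : Ideal R}
    (hI : I ≠ ⊤) : CharP (R ⧸ I) p := by
  have := Ideal.Quotient.nontrivial_iff.mpr hI
  rw [CharP.charP_iff_prime_eq_zero Fact.out, ← map_natCast (Ideal.Quotient.mk I),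
    CharP.cast_eq_zero, map_zero]

/-- In a regular local ring with finite Frobenius, the `(q - 1)`-st power of the product of a
regular system of parameters belongs to a basis over the subring of `q`-th powers. -/
theorem IsRegularSystem.exists_isFrobeniusBasis {p e : ℕ} [Fact p.Prime] {n : ℕ} {R : Type u}
    [CommRing R] [IsLocalRing R] [IsNoetherianRing R] [CharP R p]
    (hfin : (iterateFrobenius R p e).Finite) {x : Fin n → R} (hx : IsRegularSystem x) :
    ∃ (ι : Type u) (_ : Fintype ι) (v : ι → R) (i : ι),
      IsFrobeniusBasis (p ^ e) v ∧ v i = (∏ j, x j) ^ (p ^ e - 1) := by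
  induction n generalizing R with
  | zero =>
    have h : IsLocalRing.maximalIdeal R = ⊥ := by
      rw [← hx.span_range, Set.range_eq_empty, Ideal.span_empty]
    simpa using exists_isFrobeniusBasis_of_isField (IsLocalRing.isField_iff_maximalIdeal_eq.mpr h)
      hfin
  | succ n ih =>
    have hne := hx.span_singleton_ne_top 0
    have := isLocalRing_quotient hne
    have := charP_quotient (p := p) hne
    have := hx.isDomain
    have hcomp : (iterateFrobenius (R ⧸ Ideal.span {x 0}) p e).comp (Ideal.Quotient.mk _) =
        (Ideal.Quotient.mk _).comp (iterateFrobenius R p e) := by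
      ext
      simp [iterateFrobenius_def]
    obtain ⟨ι, _, v, i, hv, hvi⟩ := ih (R := R ⧸ Ideal.span {x 0}) (RingHom.Finite.of_comp_finite
      (f := Ideal.Quotient.mk _) (hcomp ▸ (RingHom.Finite.of_surjective _
        Ideal.Quotient.mk_surjective).comp hfin)) hx.quotient
    have hlift : ∃ u : ι → R, (fun i => Ideal.Quotient.mk (Ideal.span {x 0}) (u i)) = v ∧
        u i = (∏ j, x (Fin.succ j)) ^ (p ^ e - 1) := by
      classical
      choose u hu using fun i => Ideal.Quotient.mk_surjective (v i)
      refine ⟨Function.update u i ((∏ j, x (Fin.succ j)) ^ (p ^ e - 1)), funext fun j => ?_,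
        by simp⟩
      rcases eq_or_ne j i with rfl | hj
      · simp [hvi]
      · simp [hj, hu]
    obtain ⟨u, rfl, hui⟩ := hlift
    have hq : p ^ e - 1 < p ^ e := Nat.sub_lt (pow_pos (Fact.out : p.Prime).pos _) one_pos
    refine ⟨ι × Fin (p ^ e), inferInstance, _, (i, ⟨p ^ e - 1, hq⟩),
      hv.deform hfin (hx.mem_maximalIdeal 0) hx.ne_zero, ?_⟩
    simp [hui, Fin.prod_univ_succ, mul_pow]

section Socle

variable {R : Type*} [CommRing R]

lemma pow_mul_mem_of_socle {K : Ideal R} {s y : R}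
    (h : ∀ u ∉ K ⊔ Ideal.span {y}, ∃ r, u * r - s ∈ K ⊔ Ideal.span {y}) (k : ℕ) :
    ∀ u ∉ K ⊔ Ideal.span {y ^ (k + 1)}, ∃ r, u * r - y ^ k * s ∈ K ⊔ Ideal.span {y ^ (k + 1)} := by
  have mul_mem : ∀ (j l : ℕ) {z : R}, z ∈ K ⊔ Ideal.span {y ^ j} →
      y ^ l * z ∈ K ⊔ Ideal.span {y ^ (l + j)} := by
    intro j l z hz
    obtain ⟨a, ha, b, hb, rfl⟩ := Submodule.mem_sup.mp hz
    obtain ⟨c, rfl⟩ := Ideal.mem_span_singleton'.mp hb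
    rw [mul_add]
    refine Submodule.add_mem_sup (K.mul_mem_left _ ha) (Ideal.mem_span_singleton'.mpr ⟨c, by ring⟩)
  induction k with
  | zero => simpa using h
  | succ k ih =>
    intro u hu
    by_cases huy : u ∈ K ⊔ Ideal.span {y}
    · obtain ⟨a, ha, b, hb, rfl⟩ := Submodule.mem_sup.mp huy
      obtain ⟨w, rfl⟩ := Ideal.mem_span_singleton'.mp hb
      obtain ⟨r, hr⟩ := ih w fun hw => hu <| by
        refine add_mem (Submodule.mem_sup_left ha) ?_
        have := mul_mem _ 1 hw
        rwa [pow_one, mul_comm, add_comm 1] at this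
      refine ⟨r, ?_⟩
      have := add_mem (mul_mem _ 1 hr) (Submodule.mem_sup_left (K.mul_mem_right r ha))
      rw [add_comm 1 (k + 1)] at this
      convert this using 1
      ring
    · obtain ⟨r, hr⟩ := h u huy
      refine ⟨r * y ^ (k + 1), ?_⟩
      convert mul_mem 1 (k + 1) (by simpa using hr) using 1
      ring

lemma exists_mul_sub_prod_pow_mem [IsLocalRing R] {n : ℕ} {x : Fin n → R}
    (hx : Ideal.span (Set.range x) = IsLocalRing.maximalIdeal R) (k : ℕ) {u : R}
    (hu : u ∉ Ideal.span (Set.range fun i => x i ^ (k + 1))) :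
    ∃ r, u * r - (∏ i, x i) ^ k ∈ Ideal.span (Set.range fun i => x i ^ (k + 1)) := by
  suffices ∀ t : Finset (Fin n),
      ∀ u ∉ Ideal.span (Set.range fun i => if i ∈ t then x i ^ (k + 1) else x i), ∃ r,
        u * r - (∏ i ∈ t, x i) ^ k ∈
          Ideal.span (Set.range fun i => if i ∈ t then x i ^ (k + 1) else x i) by
    simpa using this Finset.univ u (by simpa using hu)
  intro t
  induction t using Finset.induction_on with
  | empty =>
    intro u hu
    simp only [Finset.notMem_empty, if_false, hx, IsLocalRing.mem_maximalIdeal, mem_nonunits_iff,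
      not_not] at hu
    obtain ⟨r, hr⟩ := hu.exists_right_inv
    exact ⟨r, by simp [hr]⟩
  | insert j t hj ih =>
    let K : Ideal R := Ideal.span ((fun i => if i ∈ t then x i ^ (k + 1) else x i) '' {j}ᶜ)
    have hrange (f : Fin n → R) :
        Ideal.span (Set.range f) = Ideal.span (f '' {j}ᶜ) ⊔ Ideal.span {f j} := by
      rw [← Ideal.span_union, ← Set.image_singleton, ← Set.image_union, Set.compl_union_self,
        Set.image_univ]
    have h1 : Ideal.span (Set.range fun i => if i ∈ t then x i ^ (k + 1) else x i) =
        K ⊔ Ideal.span {x j} := by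
      rw [hrange]
      simp [hj, K]
    have h2 : Ideal.span (Set.range fun i => if i ∈ insert j t then x i ^ (k + 1) else x i) =
        K ⊔ Ideal.span {x j ^ (k + 1)} := by
      rw [hrange]
      congr 2
      · refine Set.image_congr fun i hi => ?_
        simp [Finset.mem_insert, show i ≠ j from hi]
      · simp
    rw [h1] at ih
    rw [h2, Finset.prod_insert hj, mul_pow]
    exact pow_mul_mem_of_socle ih k

end Socle

lemma frobeniusPower_eq_map {R : Type*} [CommRing R] {p : ℕ} [ExpChar R p] (J : Ideal R) (e : ℕ) :
    frobeniusPower J (p ^ e) = J.map (iterateFrobenius R p e) :=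
  congrArg Ideal.span (Set.image_congr fun x _ => (iterateFrobenius_def p e x).symm)

lemma map_mem_of_mem_frobeniusPower {R : Type*} [CommRing R] {q : ℕ} {φ : R →+ R}
    (hφ : ∀ a x, φ (a ^ q * x) = a * φ x) {J : Ideal R} {y : R} (hy : y ∈ frobeniusPower J q) :
    φ y ∈ J := by
  suffices ∀ r, φ (r * y) ∈ J by simpa using this 1
  induction hy using Submodule.span_induction with
  | mem y hy =>
    obtain ⟨z, hz, rfl⟩ := hy
    intro r
    rw [mul_comm, hφ]
    exact J.mul_mem_right _ hz
  | zero => simp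
  | add y z _ _ hy hz =>
    intro r
    rw [mul_add, map_add]
    exact add_mem (hy r) (hz r)
  | smul a y _ hy =>
    intro r
    rw [smul_eq_mul, ← mul_assoc]
    exact hy _

namespace IsFrobeniusBasis

variable {R ι : Type*} [CommRing R] [Fintype ι] {v : ι → R}

/-- The bijection between coefficient vectors and elements given by a Frobenius basis. -/
noncomputable def equiv {q : ℕ} (hv : IsFrobeniusBasis q v) : (ι → R) ≃ R :=
  Equiv.ofBijective _ hv

lemma equiv_apply {q : ℕ} (hv : IsFrobeniusBasis q v) (a : ι → R) :
    hv.equiv a = ∑ i, a i ^ q * v i := rfl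

lemma map_sum_pow_mul {q : ℕ} {φ : R →+ R} (hφ : ∀ a x, φ (a ^ q * x) = a * φ x) (a : ι → R)
    (s : R) : φ ((∑ i, a i ^ q * v i) * s) = ∑ i, a i * φ (v i * s) := by
  simp_rw [Finset.sum_mul, map_sum, mul_assoc, hφ]

variable {p e : ℕ} [ExpChar R p]

/-- The coordinates with respect to a Frobenius basis. -/
noncomputable def coord (hv : IsFrobeniusBasis (p ^ e) v) (i : ι) : R →+ R where
  toFun r := hv.equiv.symm r i
  map_zero' := by
    rw [(Equiv.symm_apply_eq hv.equiv (y := 0)).mpr (by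
      simp [equiv_apply, zero_pow (expChar_pow_pos R p e).ne']), Pi.zero_apply]
  map_add' r s := by
    suffices hv.equiv.symm (r + s) = hv.equiv.symm r + hv.equiv.symm s from congrFun this i
    rw [Equiv.symm_apply_eq]
    conv_lhs => rw [← hv.equiv.apply_symm_apply r, ← hv.equiv.apply_symm_apply s]
    simp only [equiv_apply, Pi.add_apply, add_pow_expChar_pow, add_mul, Finset.sum_add_distrib]

lemma coord_sum (hv : IsFrobeniusBasis (p ^ e) v) (a : ι → R) (i : ι) :
    hv.coord i (∑ j, a j ^ p ^ e * v j) = a i :=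
  congrFun (hv.equiv.symm_apply_apply a) i

lemma sum_coord (hv : IsFrobeniusBasis (p ^ e) v) (r : R) :
    ∑ i, hv.coord i r ^ p ^ e * v i = r :=
  hv.equiv.apply_symm_apply r

lemma coord_pow_mul (hv : IsFrobeniusBasis (p ^ e) v) (i : ι) (a r : R) :
    hv.coord i (a ^ p ^ e * r) = a * hv.coord i r := by
  conv_lhs => rw [← hv.sum_coord r]
  simp_rw [Finset.mul_sum, ← mul_assoc, ← mul_pow]
  exact hv.coord_sum _ i

lemma coord_self (hv : IsFrobeniusBasis (p ^ e) v) (i : ι) : hv.coord i (v i) = 1 := by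
  classical
  convert hv.coord_sum (Pi.single i 1) i using 1
  · rw [Finset.sum_eq_single i] <;> simp +contextual [zero_pow (expChar_pow_pos R p e).ne']
  · simp

lemma mem_frobeniusPower_of_coord_mem (hv : IsFrobeniusBasis (p ^ e) v) {J : Ideal R} {r : R}
    (h : ∀ i, hv.coord i r ∈ J) : r ∈ frobeniusPower J (p ^ e) := by
  rw [← hv.sum_coord r]
  exact sum_mem fun i _ => Ideal.mul_mem_right _ _ (Ideal.subset_span ⟨_, h i, rfl⟩)

variable [IsLocalRing R]

lemma isUnit_det_of_socle [DecidableEq ι] (hv : IsFrobeniusBasis (p ^ e) v) {T : R →+ R}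
    (hT : ∀ a x, T (a ^ p ^ e * x) = a * T x)
    (hsoc : ∀ u ∉ frobeniusPower (IsLocalRing.maximalIdeal R) (p ^ e), ∃ r, IsUnit (T (r * u))) :
    IsUnit (Matrix.of fun i j => T (v i * v j)).det := by
  by_contra hdet
  set G : Matrix ι ι R := Matrix.of fun i j => T (v i * v j)
  have h0 : ((IsLocalRing.residue R).mapMatrix G).det = 0 := by
    rw [← RingHom.map_det, IsLocalRing.residue_eq_zero_iff]
    exact hdet
  obtain ⟨a, ha, hGa⟩ := Matrix.exists_mulVec_eq_zero_iff.mpr h0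
  choose b hb using fun i => IsLocalRing.residue_surjective (a i)
  have hmem : ∑ j, b j ^ p ^ e * v j ∈ frobeniusPower (IsLocalRing.maximalIdeal R) (p ^ e) := by
    by_contra hu
    obtain ⟨r, hr⟩ := hsoc _ hu
    refine (IsLocalRing.mem_maximalIdeal _).mp ?_ hr
    rw [← hv.sum_coord r, map_sum_pow_mul hT]
    refine sum_mem fun i _ => Ideal.mul_mem_left _ _ ?_
    rw [mul_comm, map_sum_pow_mul hT, ← IsLocalRing.residue_eq_zero_iff, map_sum]
    refine Eq.trans ?_ (congrFun hGa i)
    simp [Matrix.mulVec, dotProduct, G, hb, mul_comm]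
  refine ha (funext fun i => ?_)
  rw [← hb i, Pi.zero_apply, IsLocalRing.residue_eq_zero_iff, ← hv.coord_sum b i]
  exact map_mem_of_mem_frobeniusPower (hv.coord_pow_mul i) hmem

lemma exists_eq_trace_mul (hv : IsFrobeniusBasis (p ^ e) v) {T : R →+ R}
    (hT : ∀ a x, T (a ^ p ^ e * x) = a * T x)
    (hsoc : ∀ u ∉ frobeniusPower (IsLocalRing.maximalIdeal R) (p ^ e), ∃ r, IsUnit (T (r * u)))
    {φ : R →+ R} (hφ : ∀ a x, φ (a ^ p ^ e * x) = a * φ x) : ∃ w, ∀ r, φ r = T (r * w) := by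
  classical
  have hdet := hv.isUnit_det_of_socle hT hsoc
  set G : Matrix ι ι R := Matrix.of fun i j => T (v i * v j)
  let a := G⁻¹.mulVec fun i => φ (v i)
  have ha : G.mulVec a = fun i => φ (v i) := by
    rw [Matrix.mulVec_mulVec, Matrix.mul_nonsing_inv _ hdet, Matrix.one_mulVec]
  refine ⟨∑ j, a j ^ p ^ e * v j, fun r => ?_⟩
  have h1 := map_sum_pow_mul (v := v) hφ (fun i => hv.coord i r) 1
  simp only [hv.sum_coord, mul_one] at h1
  rw [h1]
  conv_rhs => rw [← hv.sum_coord r, map_sum_pow_mul hT]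
  refine Finset.sum_congr rfl fun i _ => ?_
  rw [mul_comm (v i), map_sum_pow_mul hT, ← congrFun ha i]
  simp [Matrix.mulVec, dotProduct, G, mul_comm]

lemma mem_frobeniusPower_of_trace_mem (hv : IsFrobeniusBasis (p ^ e) v) {T : R →+ R}
    (hT : ∀ a x, T (a ^ p ^ e * x) = a * T x)
    (hsoc : ∀ u ∉ frobeniusPower (IsLocalRing.maximalIdeal R) (p ^ e), ∃ r, IsUnit (T (r * u)))
    {J : Ideal R} {w : R} (hw : ∀ r, T (r * w) ∈ J) : w ∈ frobeniusPower J (p ^ e) := by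
  refine hv.mem_frobeniusPower_of_coord_mem fun i => ?_
  obtain ⟨z, hz⟩ := hv.exists_eq_trace_mul hT hsoc (hv.coord_pow_mul i)
  rw [hz, mul_comm]
  exact hw z

end IsFrobeniusBasis

lemma finite_iterateFrobenius {R : Type*} [CommRing R] {p : ℕ} [ExpChar R p] (h : FFinite R p)
    (e : ℕ) : (iterateFrobenius R p e).Finite := by
  have hfrob : (frobenius R p).Finite := by
    have hrange : pthPowers R p = (frobenius R p).range := by
      rw [pthPowers, show (Set.range fun x : R => x ^ p) = (frobenius R p).range from rfl,
        Subring.closure_eq]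
    have hmem (x : R) : frobenius R p x ∈ pthPowers R p := hrange ▸ ⟨x, rfl⟩
    have hsurj : Function.Surjective ((frobenius R p).codRestrict (pthPowers R p) hmem) := by
      rintro ⟨y, hy⟩
      rw [hrange] at hy
      obtain ⟨x, rfl⟩ := hy
      exact ⟨x, rfl⟩
    have hsub : (pthPowers R p).subtype.Finite := h
    exact hsub.comp (RingHom.Finite.of_surjective _ hsurj)
  induction e with
  | zero =>
    rw [iterateFrobenius_zero]
    exact RingHom.Finite.id R
  | succ e ih =>
    rw [iterateFrobenius_add, iterateFrobenius_one]
    exact ih.comp hfrob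

/-- Fedder's criterion for the existence of a splitting over a quotient of a regular local ring. -/
theorem exists_splitsAlong_quotient_iff {R : Type*} [CommRing R] [IsLocalRing R] {p e : ℕ}
    [Fact p.Prime] [CharP R p] (hreg : IsRegularLocal R) (hFF : FFinite R p) {I : Ideal R}
    (hI : I ≠ ⊤) (c : R) (A : Ideal R) :
    (∃ d ∈ A.map (Ideal.Quotient.mk I),
        SplitsAlong (R ⧸ I) (Ideal.Quotient.mk I c * d) (p ^ e)) ↔
      ¬ (Ideal.span {c} * A * Submodule.colon (frobeniusPower I (p ^ e)) I ≤
        frobeniusPower (IsLocalRing.maximalIdeal R) (p ^ e)) := by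
  have := hreg.1
  obtain ⟨s, hs, hdim⟩ := hreg.2
  have hx : IsRegularSystem fun i => (s.equivFin.symm i : R) :=
    ⟨by
      rw [← hs]
      congr 1
      ext y
      exact ⟨fun ⟨i, hi⟩ => hi ▸ (s.equivFin.symm i).2, fun h => ⟨s.equivFin ⟨y, h⟩, by simp⟩⟩,
    hdim.le⟩
  set x : Fin s.card → R := fun i => s.equivFin.symm i
  obtain ⟨ι, _, v, i₀, hv, hi₀⟩ := hx.exists_isFrobeniusBasis (finite_iterateFrobenius hFF e)
  have hpow : frobeniusPower (IsLocalRing.maximalIdeal R) (p ^ e) =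
      Ideal.span (Set.range fun i => x i ^ (p ^ e - 1 + 1)) := by
    rw [frobeniusPower_eq_map, ← hx.span_range, Ideal.map_span, ← Set.range_comp,
      Nat.sub_add_cancel (expChar_pow_pos R p e)]
    rfl
  have hsoc : ∀ u ∉ frobeniusPower (IsLocalRing.maximalIdeal R) (p ^ e),
      ∃ r, IsUnit (hv.coord i₀ (r * u)) := by
    intro u hu
    obtain ⟨r, hr⟩ := exists_mul_sub_prod_pow_mem hx.span_range (p ^ e - 1) (hpow ▸ hu)
    refine ⟨r, ?_⟩
    rw [← hpow, ← hi₀] at hr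
    have h := map_mem_of_mem_frobeniusPower (hv.coord_pow_mul i₀) hr
    rw [map_sub, hv.coord_self] at h
    by_contra hunit
    refine (Ideal.ne_top_iff_one _).mp (IsLocalRing.maximalIdeal.isMaximal R).ne_top ?_
    rw [mul_comm] at hunit
    simpa using sub_mem ((IsLocalRing.mem_maximalIdeal _).mpr hunit) h
  constructor
  · rintro ⟨_, hd, φ, hφ, hφ1⟩ hle
    obtain ⟨d, hdA, rfl⟩ :=
      (Ideal.mem_map_iff_of_surjective _ Ideal.Quotient.mk_surjective).mp hd
    choose b hb using fun i => Ideal.Quotient.mk_surjective (φ (Ideal.Quotient.mk I (v i)))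
    let ψ : R →+ R := ∑ i, (AddMonoidHom.mulRight (b i)).comp (hv.coord i)
    have hψ (r : R) : ψ r = ∑ i, hv.coord i r * b i := by simp [ψ]
    have hψlin (a r : R) : ψ (a ^ p ^ e * r) = a * ψ r := by
      simp_rw [hψ, hv.coord_pow_mul, Finset.mul_sum, mul_assoc]
    have hψφ (r : R) : Ideal.Quotient.mk I (ψ r) = φ (Ideal.Quotient.mk I r) := by
      conv_rhs => rw [← hv.sum_coord r]
      simp [hψ, hb, hφ]
    obtain ⟨w, hw⟩ := hv.exists_eq_trace_mul (hv.coord_pow_mul i₀) hsoc hψlin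
    have hwI : w ∈ Submodule.colon (frobeniusPower I (p ^ e)) I := by
      refine Submodule.mem_colon.mpr fun y hy => ?_
      refine hv.mem_frobeniusPower_of_trace_mem (hv.coord_pow_mul i₀) hsoc fun r => ?_
      rw [smul_eq_mul, mul_comm w, ← mul_assoc, ← hw, ← Ideal.Quotient.eq_zero_iff_mem, hψφ,
        Ideal.Quotient.eq_zero_iff_mem.mpr (I.mul_mem_left r hy), map_zero]
    have hmem := map_mem_of_mem_frobeniusPower (hv.coord_pow_mul i₀)
      (hle (Ideal.mul_mem_mul (Ideal.mul_mem_mul (Ideal.mem_span_singleton_self c) hdA) hwI))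
    rw [← hw] at hmem
    have h1 : 1 - ψ (c * d) ∈ IsLocalRing.maximalIdeal R := by
      refine IsLocalRing.le_maximalIdeal hI ?_
      rw [← Ideal.Quotient.eq_zero_iff_mem, map_sub, hψφ, map_mul, hφ1, map_one, sub_self]
    refine (Ideal.ne_top_iff_one _).mp (IsLocalRing.maximalIdeal.isMaximal R).ne_top ?_
    simpa using add_mem h1 hmem
  · intro hle
    rw [Ideal.mul_le] at hle
    push Not at hle
    obtain ⟨z, hz, u, hu, hzu⟩ := hle
    obtain ⟨d, hd, rfl⟩ := Ideal.mem_span_singleton_mul.mp hz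
    obtain ⟨i, hi⟩ : ∃ i, hv.coord i (c * d * u) ∉ IsLocalRing.maximalIdeal R := by
      by_contra! h
      exact hzu (hv.mem_frobeniusPower_of_coord_mem h)
    rw [IsLocalRing.mem_maximalIdeal, mem_nonunits_iff, not_not] at hi
    obtain ⟨b, hb⟩ := hi.exists_left_inv
    let ψ : R →+ R := (AddMonoidHom.mulLeft b).comp ((hv.coord i).comp (AddMonoidHom.mulRight u))
    have hψ (r : R) : ψ r = b * hv.coord i (r * u) := rfl
    have hψI : ∀ y ∈ I, (Ideal.Quotient.mk I : R →+ R ⧸ I).comp ψ y = 0 := by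
      intro y hy
      refine Ideal.Quotient.eq_zero_iff_mem.mpr (Ideal.mul_mem_left _ _ ?_)
      refine map_mem_of_mem_frobeniusPower (hv.coord_pow_mul i) ?_
      rw [AddMonoidHom.mulRight_apply, mul_comm]
      exact Submodule.mem_colon.mp hu y hy
    let φ : R ⧸ I →+ R ⧸ I :=
      QuotientAddGroup.lift I.toAddSubgroup ((Ideal.Quotient.mk I : R →+ R ⧸ I).comp ψ) hψI
    have hφ (r : R) : φ (Ideal.Quotient.mk I r) = Ideal.Quotient.mk I (ψ r) := rfl
    refine ⟨_, Ideal.mem_map_of_mem _ hd, φ, fun a r => ?_, ?_⟩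
    · obtain ⟨a, rfl⟩ := Ideal.Quotient.mk_surjective a
      obtain ⟨r, rfl⟩ := Ideal.Quotient.mk_surjective r
      rw [← map_pow, ← map_mul, hφ, hφ, ← map_mul, hψ, hψ, mul_assoc, hv.coord_pow_mul,
        mul_left_comm]
    · rw [← map_mul, hφ, hψ, hb, map_one]

lemma exists_notMem_mul_eq_zero_of_mem_minimalPrimes {S : Type*} [CommRing S] [IsReduced S]
    {P : Ideal S} (hP : P ∈ minimalPrimes S) {x : S} (hx : x ∈ P) : ∃ y ∉ P, y * x = 0 := by
  have := hP.isPrime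
  have hrad := IsLocalization.AtPrime.radical_map_of_mem_minimalPrimes
    (Localization.AtPrime P) P ⊥ hP
  have hx0 : algebraMap S (Localization.AtPrime P) x ∈
      (⊥ : Ideal (Localization.AtPrime P)).radical := by
    rw [← Ideal.map_bot (f := algebraMap S (Localization.AtPrime P)), hrad]
    exact Ideal.mem_map_of_mem _ hx
  obtain ⟨n, hn⟩ := hx0
  rw [Ideal.mem_bot, ← map_pow, IsLocalization.map_eq_zero_iff P.primeCompl] at hn
  obtain ⟨⟨y, hy⟩, hyx⟩ := hn
  refine ⟨y, hy, (pow_eq_zero_iff (n := n + 1) (by omega)).mp ?_⟩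
  dsimp only at hyx
  linear_combination y ^ n * x * hyx

/-- For a purely F-regular pair on a reduced local ring, a nonzero element outside the minimal
primes of the product of the ideals lies in no minimal prime of the ring. -/
lemma PurelyFRegularPair.notInMinimalPrimes {S : Type*} [CommRing S] [IsLocalRing S]
    [IsNoetherianRing S] [IsReduced S] {p k : ℕ} [Fact p.Prime] {a : Fin k → Ideal S}
    {t : Fin k → ℝ} (h : PurelyFRegularPair S p a t) {c : S} (hc0 : c ≠ 0)
    (hc : ∀ Q ∈ (∏ i, a i).minimalPrimes, c ∉ Q) : NotInMinimalPrimes S c := by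
  intro P hP hcP
  let N : Ideal S := Module.annihilator S (Ideal.span {c})
  let M : Ideal S := Module.annihilator S N
  have hN {z : S} : z ∈ N ↔ z * c = 0 := by
    simp [N]
  have hcM : c ∈ M := by
    refine Submodule.mem_annihilator.mpr fun z hz => ?_
    rw [smul_eq_mul, mul_comm, hN.mp hz]
  have hfin := (minimalPrimes.finite_of_isNoetherianRing S).union
    ((∏ i, a i).finite_minimalPrimes_of_isNoetherianRing S)
  obtain ⟨c', hc'J, hc'⟩ : ∃ c' ∈ N ⊔ M, ∀ Q ∈ minimalPrimes S ∪ (∏ i, a i).minimalPrimes,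
      c' ∉ Q := by
    by_contra! hcon
    obtain ⟨Q, hQ, hJQ⟩ := (Ideal.subset_union_prime (s := hfin.toFinset) (f := id) ⊥ ⊥
      (fun Q hQ _ _ => by
        rcases hfin.mem_toFinset.mp hQ with hQ | hQ
        exacts [hQ.isPrime, hQ.isPrime]) (I := N ⊔ M)).mp fun z hz => by
        simpa using hcon z hz
    have hcQ : c ∈ Q := hJQ (Ideal.mem_sup_right hcM)
    rcases hfin.mem_toFinset.mp hQ with hQ | hQ
    · obtain ⟨y, hyQ, hy⟩ := exists_notMem_mul_eq_zero_of_mem_minimalPrimes hQ hcQ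
      exact hyQ (hJQ (Ideal.mem_sup_left (hN.mpr hy)))
    · exact hc Q hQ hcQ
  obtain ⟨e, he⟩ := h c' (fun Q hQ => hc' Q (.inl hQ)) fun Q hQ => hc' Q (.inr hQ)
  obtain ⟨d, -, φ, hφ, hφ1⟩ := he e le_rfl
  have hmap {L : Ideal S} {x : S} (hx : x ∈ Module.annihilator S L) :
      φ (x * d) ∈ Module.annihilator S L := by
    refine Submodule.mem_annihilator.mpr fun z hz => ?_
    rw [smul_eq_mul, mul_comm, ← hφ]
    have hxz : x * z = 0 := Submodule.mem_annihilator.mp hx z hz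
    obtain ⟨q, hq⟩ := Nat.exists_eq_succ_of_ne_zero
      (pow_pos (Fact.out : p.Prime).pos e).ne'
    rw [hq, pow_succ, mul_assoc, ← mul_assoc z, mul_comm z, hxz, zero_mul, mul_zero, map_zero]
  obtain ⟨x, hx, y, hy, rfl⟩ := Submodule.mem_sup.mp hc'J
  rw [add_mul, map_add] at hφ1
  have hN1 : N ≠ ⊤ := fun h1 => hc0 <| by
    rw [← one_mul c]
    exact hN.mp (h1 ▸ Submodule.mem_top)
  have hM1 : M ≠ ⊤ := fun h1 => by
    obtain ⟨y, hyP, hy⟩ := exists_notMem_mul_eq_zero_of_mem_minimalPrimes hP hcP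
    have : (1 : S) * y = 0 :=
      Submodule.mem_annihilator.mp (h1 ▸ Submodule.mem_top : (1 : S) ∈ M) y (hN.mpr hy)
    rw [one_mul] at this
    exact hyP (this ▸ P.zero_mem)
  refine (Ideal.ne_top_iff_one _).mp (IsLocalRing.maximalIdeal.isMaximal S).ne_top ?_
  rw [← hφ1]
  exact add_mem (IsLocalRing.le_maximalIdeal hN1 (hmap hx))
    (IsLocalRing.le_maximalIdeal hM1 (hmap hy))

lemma forall_mem_minimalPrimes_map_mk_iff {R : Type*} [CommRing R] {I J : Ideal R} {c : R} :
    (∀ P ∈ (J.map (Ideal.Quotient.mk I)).minimalPrimes, Ideal.Quotient.mk I c ∉ P) ↔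
      ∀ P ∈ (J + I).minimalPrimes, c ∉ P := by
  rw [Ideal.minimalPrimes_map_of_surjective Ideal.Quotient.mk_surjective, Ideal.mk_ker,
    Set.forall_mem_image]
  refine forall₂_congr fun P hP => not_congr ?_
  rw [← Ideal.mem_comap, Ideal.comap_map_of_surjective _ Ideal.Quotient.mk_surjective,
    ← RingHom.ker_eq_comap_bot, Ideal.mk_ker, sup_eq_left.mpr (le_sup_right.trans hP.le)]

lemma Ideal.prod_map_pow {R S ι : Type*} [CommRing R] [CommRing S] [Fintype ι] (f : R →+* S)
    (a : ι → Ideal R) (n : ι → ℕ) : ∏ i, (a i).map f ^ n i = (∏ i, a i ^ n i).map f := by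
  simp_rw [← Ideal.map_pow]
  exact (map_prod (Ideal.mapHom f) _ _).symm

/-- Fedder type criterion for pure F-regularity of the pair
`(R/I, (a₁S)^{t₁} ⋯ (a_kS)^{t_k})`. -/
theorem fedder_purelyFRegular {R : Type*} [CommRing R] [IsLocalRing R] (p : ℕ)
    [Fact p.Prime] [CharP R p] (hreg : IsRegularLocal R) (hFF : FFinite R p)
    (I : Ideal R) (hIrad : I.IsRadical) (hIne : I ≠ ⊤) {k : ℕ}
    (a : Fin k → Ideal R) (t : Fin k → ℝ) (ht : ∀ i, 0 < t i) :
    PurelyFRegularPair (R ⧸ I) p (fun i => (a i).map (Ideal.Quotient.mk I)) t ↔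
      ∀ c : R, c ∉ I → (∀ P ∈ ((∏ i, a i) + I).minimalPrimes, c ∉ P) →
        ∃ e₀ : ℕ, ∀ e : ℕ, e₀ ≤ e →
          ¬ (Ideal.span {c} * (∏ i, a i ^ ⌊t i * ((p ^ e : ℝ) - 1)⌋₊) *
                Submodule.colon (frobeniusPower I (p ^ e)) I ≤
              frobeniusPower (IsLocalRing.maximalIdeal R) (p ^ e)) := by
  have := hreg.1
  have := isLocalRing_quotient hIne
  have : IsReduced (R ⧸ I) := (Ideal.isRadical_iff_quotient_reduced I).mp hIrad
  have hprod : ∏ i, (a i).map (Ideal.Quotient.mk I) = (∏ i, a i).map (Ideal.Quotient.mk I) := by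
    simpa using Ideal.prod_map_pow (Ideal.Quotient.mk I) a 1
  constructor
  · intro h c hcI hc
    have hc' := forall_mem_minimalPrimes_map_mk_iff.mpr hc
    rw [← hprod] at hc'
    have hcS := h.notInMinimalPrimes (mt Ideal.Quotient.eq_zero_iff_mem.mp hcI) hc'
    obtain ⟨e₀, he₀⟩ := h _ hcS hc'
    refine ⟨e₀, fun e he => (exists_splitsAlong_quotient_iff hreg hFF hIne c _).mp ?_⟩
    rw [← Ideal.prod_map_pow]
    exact he₀ e he
  · intro h c hcS hc
    obtain ⟨c, rfl⟩ := Ideal.Quotient.mk_surjective c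
    rw [hprod, forall_mem_minimalPrimes_map_mk_iff] at hc
    have hcI : c ∉ I := fun hcI => by
      obtain ⟨P, hP⟩ := Ideal.nonempty_minimalPrimes (bot_ne_top (α := Ideal (R ⧸ I)))
      exact hcS P hP (Ideal.Quotient.eq_zero_iff_mem.mpr hcI ▸ P.zero_mem)
    obtain ⟨e₀, he₀⟩ := h c hcI hc
    refine ⟨e₀, fun e he => ?_⟩
    rw [Ideal.prod_map_pow]
    exact (exists_splitsAlong_quotient_iff hreg hFF hIne c _).mpr (he₀ e he)
end

section
/- (F-adjunction, F-pure case.) Let (R, m) be an F-finite regular local ring of prime characteristic p > 0 and I ⊊ R an unmixed reduced ideal of height h > 0. Let a₁,…,a_k be ideals of R and t₁,…,t_k > 0 real numbers, and write S = R/I. If the pair (R, I^h·a₁^{t₁}⋯a_k^{t_k}) (the pair with ideals I, a₁,…,a_k and exponents h, t₁,…,t_k) is F-pure, then the pair (S, (a₁S)^{t₁}⋯(a_kS)^{t_k}) is F-pure. -/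
open IsLocalRing

section LengthBounds

variable {A : Type*} [CommRing A]

theorem length_quotient_sup_span_mul_le (K : Ideal A) (a b : A) :
    Module.length A (A ⧸ (K ⊔ Ideal.span {a * b})) ≤
      Module.length A (A ⧸ (K ⊔ Ideal.span {a})) +
        Module.length A (A ⧸ (K ⊔ Ideal.span {b})) := by
  have hle : K ⊔ Ideal.span {a * b} ≤ K ⊔ Ideal.span {a} :=
    sup_le_sup_left
      (Ideal.span_singleton_le_span_singleton.mpr (dvd_mul_right a b)) K
  have hmul : K ⊔ Ideal.span {b} ≤
      Submodule.comap (LinearMap.mulLeft A a) (K ⊔ Ideal.span {a * b}) := by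
    refine sup_le (fun x hx => Ideal.mem_sup_left (K.mul_mem_left a hx)) ?_
    rw [Ideal.span_singleton_le_iff_mem]
    exact Ideal.mem_sup_right (Ideal.mem_span_singleton_self _)
  let g := Submodule.factor hle
  let f := Submodule.mapQ _ _ (LinearMap.mulLeft A a) hmul
  have hker : LinearMap.ker g ≤ LinearMap.range f := by
    intro x hx
    obtain ⟨x, rfl⟩ := Submodule.Quotient.mk_surjective _ x
    have hx' : x ∈ K ⊔ Ideal.span {a} :=
      (Submodule.Quotient.mk_eq_zero _).mp hx
    rw [sup_comm, Ideal.mem_span_singleton_sup] at hx'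
    obtain ⟨c, k, hk, rfl⟩ := hx'
    refine ⟨Submodule.Quotient.mk c, ?_⟩
    rw [Submodule.mapQ_apply, Submodule.Quotient.eq]
    refine Ideal.mem_sup_left ?_
    have : LinearMap.mulLeft A a c - (c * a + k) = -k := by
      simp [mul_comm]
    rw [this]
    exact K.neg_mem hk
  rw [Module.length_eq_add_of_exact (LinearMap.ker g).subtype g
    (Submodule.injective_subtype _) (Submodule.factor_surjective hle)
    (LinearMap.exact_subtype_ker_map g), add_comm]
  gcongr
  refine le_trans ?_ (Module.length_le_of_surjective f.rangeRestrict
    f.surjective_rangeRestrict)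
  exact Module.length_le_of_injective (Submodule.inclusion hker)
    (Submodule.inclusion_injective hker)

theorem length_quotient_sup_span_pow_le (K : Ideal A) (a : A) (n : ℕ) :
    Module.length A (A ⧸ (K ⊔ Ideal.span {a ^ n})) ≤
      n * Module.length A (A ⧸ (K ⊔ Ideal.span {a})) := by
  induction n with
  | zero =>
    have : K ⊔ Ideal.span {a ^ 0} = ⊤ := by simp
    rw [this]
    simp [Module.length_eq_zero]
  | succ n ih =>
    rw [pow_succ]
    refine (length_quotient_sup_span_mul_le K _ a).trans ?_
    push_cast
    rw [add_mul, one_mul]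
    gcongr

theorem length_quotient_sup_iSup_span_pow_le (n : ℕ) (s : Finset A) :
    ∀ K : Ideal A, Module.length A (A ⧸ (K ⊔ ⨆ i ∈ s, Ideal.span {i ^ n})) ≤
      (n : ℕ∞) ^ s.card * Module.length A (A ⧸ (K ⊔ ⨆ i ∈ s, Ideal.span {i})) := by
  classical
  induction s using Finset.induction_on with
  | empty =>
    intro K
    have h : ∀ f : A → Ideal A, ⨆ i ∈ (∅ : Finset A), f i = ⊥ := by simp
    rw [h, h, Finset.card_empty, pow_zero, one_mul]
  | insert b s hb ih =>
    intro K
    rw [Finset.iSup_insert, Finset.iSup_insert, Finset.card_insert_of_notMem hb,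
      sup_comm (Ideal.span {b ^ n}), ← sup_assoc, ← sup_assoc, pow_succ', mul_assoc]
    refine (length_quotient_sup_span_pow_le _ b n).trans ?_
    gcongr
    rw [sup_right_comm]
    exact ih _

end LengthBounds

section Monomials

variable {A : Type*} [CommRing A] [IsLocalRing A]

/-- If the values at `x` of forms of degree `d` with a unit coefficient stay outside
`𝔪 ^ (d + 1)`, then monomials of degree less than `M` contribute independently to the
length of `A ⧸ 𝔪 ^ M`. -/
theorem card_le_length_quotient_maximalIdeal_pow {σ : Type*} (x : σ → A)
    (hx : ∀ (d : ℕ) (F : MvPolynomial σ A), F.IsHomogeneous d →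
      MvPolynomial.map (residue A) F ≠ 0 → MvPolynomial.eval x F ∉ maximalIdeal A ^ (d + 1))
    (hxm : ∀ i, x i ∈ maximalIdeal A)
    (M : ℕ) (T : Finset (σ →₀ ℕ)) (hT : ∀ α ∈ T, α.degree < M) :
    (T.card : ℕ∞) ≤ Module.length A (A ⧸ maximalIdeal A ^ M) := by
  classical
  have hmon : ∀ α : σ →₀ ℕ,
      MvPolynomial.eval x (MvPolynomial.monomial α 1) ∈ maximalIdeal A ^ α.degree := by
    intro α
    rw [MvPolynomial.eval_monomial, one_mul, Finsupp.prod, Finsupp.degree_apply,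
      ← Finset.prod_pow_eq_pow_sum]
    exact Ideal.prod_mem_prod fun i _ => Ideal.pow_mem_pow (hxm i) _
  let v : (σ →₀ ℕ) → A := fun α => MvPolynomial.eval x (MvPolynomial.monomial α 1)
  rw [Module.length_quotient]
  suffices H : Order.coheight (maximalIdeal A ^ M ⊔ Ideal.span (v '' T)) + T.card ≤
      Order.coheight (maximalIdeal A ^ M) from le_trans le_add_self H
  revert hT
  induction T using Finset.induction_on_min_value (fun α : σ →₀ ℕ => α.degree) with
  | empty => simp
  | insert α T hα hmin ih =>
    intro hT
    refine le_trans ?_ (ih fun β hβ => hT β (Finset.mem_insert_of_mem hβ))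
    rw [Finset.card_insert_of_notMem hα]
    push_cast
    rw [add_comm (T.card : ℕ∞), ← add_assoc]
    gcongr
    refine Order.coheight_add_one_le (lt_of_le_of_ne ?_ ?_)
    · gcongr
      simp
    intro heq
    have hmem : v α ∈ maximalIdeal A ^ M ⊔ Ideal.span (v '' T) := by
      rw [heq]
      exact Ideal.mem_sup_right (Ideal.subset_span ⟨α, by simp, rfl⟩)
    obtain ⟨u, hu, w, hw, huw⟩ := Submodule.mem_sup.mp hmem
    rw [Ideal.span, Submodule.mem_span_image_finset_iff_exists_fun] at hw
    obtain ⟨c, rfl⟩ := hw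
    let F : MvPolynomial σ A := MvPolynomial.monomial α 1 -
      ∑ i : T, if (i : σ →₀ ℕ).degree = α.degree then MvPolynomial.monomial (i : σ →₀ ℕ) (c i)
        else 0
    refine hx α.degree F ?_ ?_ ?_
    · refine (MvPolynomial.homogeneousSubmodule σ A _).sub_mem
        (MvPolynomial.isHomogeneous_monomial _ rfl)
        (Submodule.sum_mem _ fun i _ => ?_)
      split_ifs with h
      · exact MvPolynomial.isHomogeneous_monomial _ h
      · exact Submodule.zero_mem _
    · intro h0
      have h1 := congrArg (MvPolynomial.coeff α) h0
      have h2 : MvPolynomial.coeff α F = 1 := by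
        simp only [F, MvPolynomial.coeff_sub, MvPolynomial.coeff_sum,
          MvPolynomial.coeff_monomial, if_true]
        rw [Finset.sum_eq_zero, sub_zero]
        intro i _
        have : (i : σ →₀ ℕ) ≠ α := fun h => hα (h ▸ i.2)
        split_ifs <;> simp [MvPolynomial.coeff_monomial, this]
      rw [MvPolynomial.coeff_map, h2] at h1
      simp at h1
    · have hF : MvPolynomial.eval x F = u +
          ∑ i : T, if (i : σ →₀ ℕ).degree = α.degree then 0 else c i • v i := by
        have : MvPolynomial.eval x F = v α - ∑ i : T,
            if (i : σ →₀ ℕ).degree = α.degree then c i • v i else 0 := by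
          simp only [F, v, map_sub, map_sum]
          congr 1
          refine Finset.sum_congr rfl fun i _ => ?_
          split_ifs <;> simp [MvPolynomial.eval_monomial]
        rw [this, ← huw, add_sub_assoc, ← Finset.sum_sub_distrib]
        congr 1
        refine Finset.sum_congr rfl fun i _ => ?_
        split_ifs <;> simp
      rw [hF]
      refine Ideal.add_mem _
        (Ideal.pow_le_pow_right (hT α (Finset.mem_insert_self _ _)) hu)
        (Ideal.sum_mem _ fun i _ => ?_)
      split_ifs with h
      · exact Ideal.zero_mem _
      · refine Ideal.mul_mem_left _ _ (Ideal.pow_le_pow_right ?_ (hmon i))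
        exact lt_of_le_of_ne (hmin i i.2) (Ne.symm h)

/-- More than `dim A` elements of the maximal ideal are analytically dependent. -/
theorem exists_isHomogeneous_eval_mem_maximalIdeal_pow [IsNoetherianRing A]
    (t : Finset A) (ht : maximalIdeal A ∈ (Ideal.span (t : Set A)).minimalPrimes)
    {s : ℕ} (hs : t.card < s) (x : Fin s → A) (hxm : ∀ i, x i ∈ maximalIdeal A) :
    ∃ (d : ℕ) (F : MvPolynomial (Fin s) A), F.IsHomogeneous d ∧
      MvPolynomial.map (residue A) F ≠ 0 ∧
        MvPolynomial.eval x F ∈ maximalIdeal A ^ (d + 1) := by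
  classical
  by_contra! hx
  have hart := quotient_artinian_of_mem_minimalPrimes_of_isLocalRing _ ht
  have hfin : Module.length A (A ⧸ Ideal.span (t : Set A)) ≠ ⊤ := by
    rw [Module.length_eq_of_surjective (R := A ⧸ Ideal.span (t : Set A))
      Ideal.Quotient.mk_surjective]
    exact Module.length_ne_top
  obtain ⟨L, hL⟩ := ENat.ne_top_iff_exists.mp hfin
  have hspan : (⊥ : Ideal A) ⊔ ⨆ i ∈ t, Ideal.span {i} = Ideal.span (t : Set A) := by
    rw [bot_sup_eq]
    simp only [Ideal.span, ← Submodule.span_iUnion₂]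
    congr 1
    ext; simp
  have key : ∀ n : ℕ, 0 < n → n ^ s ≤ (s * n) ^ t.card * L := by
    intro n hn
    let T : Finset (Fin s →₀ ℕ) := (Fintype.piFinset fun _ => Finset.range n).map
      Finsupp.equivFunOnFinite.symm.toEmbedding
    have hTcard : T.card = n ^ s := by simp [T]
    have h1 := card_le_length_quotient_maximalIdeal_pow x hx hxm (s * n) T (by
      intro α hα
      obtain ⟨g, hg, rfl⟩ := Finset.mem_map.mp hα
      rw [Fintype.mem_piFinset] at hg
      have : (Finsupp.equivFunOnFinite.symm g).degree = ∑ i, g i := by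
        rw [Finsupp.degree_eq_sum]; rfl
      simp only [Equiv.coe_toEmbedding, this]
      have hs0 : (Finset.univ : Finset (Fin s)).Nonempty :=
        ⟨⟨0, by omega⟩, Finset.mem_univ _⟩
      calc ∑ i, g i < ∑ _i : Fin s, n :=
            Finset.sum_lt_sum_of_nonempty hs0 fun i _ => Finset.mem_range.mp (hg i)
        _ = s * n := by simp)
    have h2 : (⊥ : Ideal A) ⊔ ⨆ i ∈ t, Ideal.span {i ^ (s * n)} ≤ maximalIdeal A ^ (s * n) := by
      refine sup_le bot_le (iSup₂_le fun i hi => ?_)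
      rw [Ideal.span_singleton_le_iff_mem]
      exact Ideal.pow_mem_pow (ht.1.2 (Ideal.subset_span hi)) _
    have h3 := length_quotient_sup_iSup_span_pow_le (s * n) t ⊥
    rw [hspan, ← hL] at h3
    have h4 : Module.length A (A ⧸ maximalIdeal A ^ (s * n)) ≤
        Module.length A (A ⧸ ((⊥ : Ideal A) ⊔ ⨆ i ∈ t, Ideal.span {i ^ (s * n)})) := by
      rw [Module.length_quotient, Module.length_quotient]
      exact Order.coheight_anti h2
    have h5 := h1.trans (h4.trans h3)
    rw [hTcard] at h5
    exact_mod_cast h5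
  have h1 := key (s ^ t.card * L + 1) (Nat.succ_pos _)
  set n := s ^ t.card * L + 1 with hn
  have h2 : n ^ (t.card + 1) ≤ n ^ s := Nat.pow_le_pow_right (Nat.succ_pos _) hs
  have h3 : n ^ (t.card + 1) ≤ n ^ t.card * (s ^ t.card * L) := by
    refine (h2.trans h1).trans_eq ?_
    rw [mul_pow]; ring
  rw [pow_succ] at h3
  have := Nat.le_of_mul_le_mul_left h3 (Nat.pow_pos (Nat.succ_pos _))
  omega

end Monomials

section Reductions

variable {A : Type*} [CommRing A]

theorem multiset_prod_sub_prod_mem_mul_pow {σ : Type*} {J I : Ideal A} {a b : σ → A}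
    (ha : ∀ i, a i ∈ I) (hb : ∀ i, b i ∈ I) (hab : ∀ i, a i - b i ∈ J) (s : Multiset σ) :
    (s.map a).prod - (s.map b).prod ∈ J * I ^ (s.card - 1) := by
  induction s using Multiset.induction_on with
  | empty => simp
  | cons i s ih =>
    have hprod : (s.map b).prod ∈ I ^ s.card := by
      clear ih
      induction s using Multiset.induction_on with
      | empty => simp
      | cons j s ih =>
        rw [Multiset.map_cons, Multiset.prod_cons, Multiset.card_cons, pow_succ']
        exact Ideal.mul_mem_mul (hb j) ih
    have h1 : (a i - b i) * (s.map b).prod ∈ J * I ^ s.card := Ideal.mul_mem_mul (hab i) hprod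
    have h2 : a i * ((s.map a).prod - (s.map b).prod) ∈ J * I ^ s.card := by
      rcases Multiset.empty_or_exists_mem s with rfl | ⟨j, hj⟩
      · simp
      · have hpos : s.card - 1 + 1 = s.card := by
          have := Multiset.card_pos_iff_exists_mem.mpr ⟨j, hj⟩
          omega
        rw [← hpos, pow_succ', ← mul_assoc, mul_comm J, mul_assoc]
        exact Ideal.mul_mem_mul (ha i) ih
    rw [Multiset.map_cons, Multiset.map_cons, Multiset.prod_cons, Multiset.prod_cons,
      Multiset.card_cons, Nat.add_sub_cancel]
    convert Ideal.add_mem _ h1 h2 using 1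
    ring

theorem MvPolynomial.IsHomogeneous.eval_sub_eval_mem_mul_pow {σ : Type*}
    {J I : Ideal A} {a b : σ → A}
    (ha : ∀ i, a i ∈ I) (hb : ∀ i, b i ∈ I) (hab : ∀ i, a i - b i ∈ J)
    {F : MvPolynomial σ A} {d : ℕ} (hF : F.IsHomogeneous d) :
    MvPolynomial.eval a F - MvPolynomial.eval b F ∈ J * I ^ (d - 1) := by
  have hmul : ∀ (x : σ → A) (α : σ →₀ ℕ),
      ∏ i ∈ α.support, x i ^ α i = (α.toMultiset.map x).prod := by
    intro x α
    rw [Finsupp.toMultiset_map, Finsupp.prod_toMultiset, Finsupp.prod_mapDomain_index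
      (fun _ => pow_zero _) (fun _ _ _ => pow_add _ _ _)]
    rfl
  rw [MvPolynomial.eval_eq, MvPolynomial.eval_eq, ← Finset.sum_sub_distrib]
  refine Ideal.sum_mem _ fun α hα => ?_
  rw [← mul_sub]
  refine Ideal.mul_mem_left _ _ ?_
  have hdeg : α.toMultiset.card = d := by
    rw [Finsupp.card_toMultiset, ← hF (MvPolynomial.mem_support_iff.mp hα)]
    simp [Finsupp.weight_apply, Finsupp.sum]
  rw [hmul, hmul, ← hdeg]
  exact multiset_prod_sub_prod_mem_mul_pow ha hb hab _

theorem Ideal.sup_span_singleton_pow_le {J I : Ideal A} {z : A} (hJ : J ≤ I) (hz : z ∈ I)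
    (n : ℕ) : (J ⊔ Ideal.span {z}) ^ (n + 1) ≤ J * I ^ n ⊔ Ideal.span {z ^ (n + 1)} := by
  have hz' : Ideal.span {z} ≤ I := (Ideal.span_singleton_le_iff_mem I).mpr hz
  induction n with
  | zero => simp
  | succ n ih =>
    rw [pow_succ]
    refine (Ideal.mul_mono_left ih).trans ?_
    rw [Ideal.sup_mul, Ideal.mul_sup]
    refine sup_le ?_ ?_
    · refine le_sup_of_le_left ?_
      rw [← Ideal.mul_sup, mul_assoc, pow_succ]
      exact Ideal.mul_mono_right (Ideal.mul_mono_right (sup_le hJ hz'))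
    · rw [Ideal.mul_sup]
      refine sup_le (le_sup_of_le_left ?_) (le_sup_of_le_right ?_)
      · rw [mul_comm, ← Ideal.span_singleton_pow]
        exact Ideal.mul_mono_right (Ideal.pow_right_mono hz' _)
      · rw [Ideal.span_singleton_mul_span_singleton, ← pow_succ]

theorem Ideal.pow_add_le_of_pow_succ_le {I J : Ideal A} {N : ℕ} (h : I ^ (N + 1) ≤ J * I ^ N)
    (n : ℕ) : I ^ (N + n) ≤ J ^ n * I ^ N := by
  induction n with
  | zero => simp
  | succ n ih =>
    calc I ^ (N + (n + 1)) = I ^ (N + n) * I := by rw [← add_assoc, pow_succ]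
      _ ≤ J ^ n * I ^ N * I := Ideal.mul_mono_left ih
      _ = J ^ n * I ^ (N + 1) := by rw [mul_assoc, pow_succ]
      _ ≤ J ^ n * (J * I ^ N) := Ideal.mul_mono_right h
      _ = J ^ (n + 1) * I ^ N := by rw [pow_succ, mul_assoc]

theorem Ideal.iSup_pow_le_iSup_pow {ι : Type*} (I : ι → Ideal A) (n : ℕ) (s : Finset ι) :
    (⨆ i ∈ s, I i) ^ (s.card * n + 1) ≤ ⨆ i ∈ s, I i ^ n := by
  classical
  induction s using Finset.induction_on with
  | empty =>
    have h : ∀ f : ι → Ideal A, ⨆ i ∈ (∅ : Finset ι), f i = ⊥ := by simp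
    rw [h, h, Finset.card_empty, zero_mul, zero_add, pow_one]
  | insert b s hb ih =>
    rw [Finset.iSup_insert, Finset.iSup_insert, Finset.card_insert_of_notMem hb,
      show (s.card + 1) * n + 1 = n + (s.card * n + 1) by ring]
    exact Ideal.sup_pow_add_le_pow_sup_pow.trans (sup_le_sup_left ih _)

variable [IsLocalRing A] [IsNoetherianRing A]

/-- An analytic relation among the generators of a reduction of the maximal ideal allows one
generator to be dropped, provided the residue field is infinite. -/
theorem exists_reduction_of_isHomogeneous [Infinite (ResidueField A)] {s : ℕ}
    {x : Fin (s + 1) → A} (hxm : ∀ i, x i ∈ maximalIdeal A) {N : ℕ}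
    (hN : maximalIdeal A ^ (N + 1) ≤ Ideal.span (Set.range x) * maximalIdeal A ^ N)
    {d : ℕ} {F : MvPolynomial (Fin (s + 1)) A} (hF : F.IsHomogeneous d)
    (hF0 : MvPolynomial.map (residue A) F ≠ 0)
    (hFx : MvPolynomial.eval x F ∈ maximalIdeal A ^ (d + 1)) :
    ∃ (y : Fin s → A) (N' : ℕ), (∀ i, y i ∈ maximalIdeal A) ∧
      maximalIdeal A ^ (N' + 1) ≤ Ideal.span (Set.range y) * maximalIdeal A ^ N' := by
  set m := maximalIdeal A with hm
  let G := F * MvPolynomial.X (Fin.last s)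
  have hG : G.IsHomogeneous (d + 1) := hF.mul (MvPolynomial.isHomogeneous_X _ _)
  have hG0 : MvPolynomial.map (residue A) G ≠ 0 := by
    simpa [G] using hF0
  have hGx : MvPolynomial.eval x G ∈ m ^ (d + 2) := by
    rw [map_mul, MvPolynomial.eval_X, pow_succ]
    exact Ideal.mul_mem_mul hFx (hxm _)
  obtain ⟨c₀, hc₀⟩ : ∃ c₀, MvPolynomial.eval c₀ (MvPolynomial.map (residue A) G) ≠ 0 := by
    by_contra! h
    exact hG0 (MvPolynomial.funext fun c => by simpa using h c)
  choose c hc using fun i => residue_surjective (c₀ i)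
  have hc' : c₀ = fun i => residue A (c i) := funext fun i => (hc i).symm
  have hev : residue A (MvPolynomial.eval c G) ≠ 0 := by
    rw [hc', MvPolynomial.eval_map] at hc₀
    rwa [← MvPolynomial.eval₂_id, MvPolynomial.hom_eval₂, RingHom.comp_id]
  have hunit : IsUnit (MvPolynomial.eval c G) := (residue_ne_zero_iff_isUnit _).mp hev
  have hlast : IsUnit (c (Fin.last s)) := by
    simp only [G, map_mul, MvPolynomial.eval_X] at hunit
    exact isUnit_of_mul_isUnit_right hunit
  obtain ⟨u, hu⟩ := hlast.exists_right_inv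
  let z := u * x (Fin.last s)
  have hz : z ∈ m := m.mul_mem_left _ (hxm _)
  let y : Fin s → A := fun i => x i.castSucc - c i.castSucc * z
  have hy : ∀ i, y i ∈ m := fun i => m.sub_mem (hxm _) (m.mul_mem_left _ hz)
  let J := Ideal.span (Set.range y)
  have hJm : J ≤ m := Ideal.span_le.mpr (Set.range_subset_iff.mpr hy)
  have hxJ : ∀ i, x i - c i * z ∈ J := by
    intro i
    induction i using Fin.lastCases with
    | last =>
      have : x (Fin.last s) - c (Fin.last s) * z = 0 := by
        rw [← mul_assoc, hu, one_mul, sub_self]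
      rw [this]
      exact J.zero_mem
    | cast i => exact Ideal.subset_span ⟨i, rfl⟩
  have hxJz : Ideal.span (Set.range x) ≤ J ⊔ Ideal.span {z} := by
    refine Ideal.span_le.mpr (Set.range_subset_iff.mpr fun i => ?_)
    rw [← sub_add_cancel (x i) (c i * z)]
    exact Ideal.add_mem _ (Ideal.mem_sup_left (hxJ i))
      (Ideal.mem_sup_right (Ideal.mul_mem_left _ _ (Ideal.mem_span_singleton_self z)))
  have hscale : MvPolynomial.eval (fun i => c i * z) G = z ^ (d + 1) * MvPolynomial.eval c G := by
    rw [MvPolynomial.eval_eq', MvPolynomial.eval_eq', Finset.mul_sum]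
    refine Finset.sum_congr rfl fun α hα => ?_
    have hdeg : ∑ i, α i = d + 1 := by
      rw [← hG (MvPolynomial.mem_support_iff.mp hα)]
      simp [Finsupp.weight_apply, Finsupp.sum_fintype]
    simp_rw [mul_pow]
    rw [Finset.prod_mul_distrib, Finset.prod_pow_eq_pow_sum, hdeg]
    ring
  have hdiff : MvPolynomial.eval x G - MvPolynomial.eval (fun i => c i * z) G ∈ J * m ^ d :=
    hG.eval_sub_eval_mem_mul_pow hxm (fun i => m.mul_mem_left _ hz) hxJ
  have hzpow : z ^ (d + 1) ∈ J * m ^ d ⊔ m ^ (d + 2) := by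
    rw [← Ideal.mul_unit_mem_iff_mem _ hunit, ← hscale, ← sub_sub_cancel
      (MvPolynomial.eval x G) (MvPolynomial.eval (fun i => c i * z) G)]
    exact Ideal.sub_mem _ (Ideal.mem_sup_right hGx) (Ideal.mem_sup_left hdiff)
  refine ⟨y, N + d, hy, ?_⟩
  refine Submodule.le_of_le_smul_of_le_jacobson_bot (I := m) (IsNoetherian.noetherian _)
    (IsLocalRing.jacobson_eq_maximalIdeal _ bot_ne_top).ge ?_
  calc m ^ (N + d + 1) ≤ Ideal.span (Set.range x) ^ (d + 1) * m ^ N :=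
        Ideal.pow_add_le_of_pow_succ_le hN (d + 1)
    _ ≤ (J * m ^ d ⊔ m ^ (d + 2)) * m ^ N := by
        refine Ideal.mul_mono_left ?_
        refine (Ideal.pow_right_mono hxJz _).trans
          ((Ideal.sup_span_singleton_pow_le hJm hz d).trans (sup_le le_sup_left ?_))
        rwa [Ideal.span_singleton_le_iff_mem]
    _ = J * m ^ (N + d) ⊔ m • m ^ (N + d + 1) := by
        rw [Ideal.sup_mul, smul_eq_mul, mul_assoc, ← pow_add, ← pow_add, ← pow_succ']
        congr 2 <;> ring_nf

/-- Over an infinite residue field, the maximal ideal has a reduction with at most `dim A`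
generators. -/
theorem exists_reduction_maximalIdeal [Infinite (ResidueField A)]
    (t : Finset A) (ht : maximalIdeal A ∈ (Ideal.span (t : Set A)).minimalPrimes) :
    ∃ s ≤ t.card, ∃ (x : Fin s → A) (N : ℕ), (∀ i, x i ∈ maximalIdeal A) ∧
      maximalIdeal A ^ (N + 1) ≤ Ideal.span (Set.range x) * maximalIdeal A ^ N := by
  suffices H : ∀ s : ℕ, (∃ (x : Fin s → A) (N : ℕ), (∀ i, x i ∈ maximalIdeal A) ∧
      maximalIdeal A ^ (N + 1) ≤ Ideal.span (Set.range x) * maximalIdeal A ^ N) →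
      ∃ s ≤ t.card, ∃ (x : Fin s → A) (N : ℕ), (∀ i, x i ∈ maximalIdeal A) ∧
      maximalIdeal A ^ (N + 1) ≤ Ideal.span (Set.range x) * maximalIdeal A ^ N by
    obtain ⟨s, x, hx⟩ := Submodule.fg_iff_exists_fin_generating_family.mp
      (IsNoetherian.noetherian (maximalIdeal A))
    have hx' : Ideal.span (Set.range x) = maximalIdeal A := hx
    refine H s ⟨x, 0, fun i => hx' ▸ Ideal.subset_span ⟨i, rfl⟩, ?_⟩
    simp [hx']
  intro s
  induction s with
  | zero => exact fun h => ⟨0, Nat.zero_le _, h⟩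
  | succ s ih =>
    intro h
    rcases le_or_gt (s + 1) t.card with hle | hlt
    · exact ⟨s + 1, hle, h⟩
    · obtain ⟨x, N, hxm, hN⟩ := h
      obtain ⟨d, F, hF, hF0, hFx⟩ :=
        exists_isHomogeneous_eval_mem_maximalIdeal_pow t ht hlt x hxm
      exact ih (exists_reduction_of_isHomogeneous hxm hN hF hF0 hFx)

end Reductions

theorem Ideal.pow_le_frobeniusPower_of_reduction {A : Type*} [CommRing A] {I : Ideal A}
    {s h N : ℕ} (hs : s ≤ h) {x : Fin s → A} (hx : ∀ i, x i ∈ I)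
    (hN : I ^ (N + 1) ≤ Ideal.span (Set.range x) * I ^ N) (q : ℕ) :
    I ^ (h * q + (N + 1)) ≤ frobeniusPower I q := by
  have hspan : Ideal.span (Set.range x) = ⨆ i ∈ (Finset.univ : Finset (Fin s)),
      Ideal.span {x i} := by
    simp [Ideal.span_range_eq_iSup]
  calc I ^ (h * q + (N + 1)) ≤ I ^ (N + (s * q + 1)) := by
        refine Ideal.pow_le_pow_right ?_
        have := Nat.mul_le_mul_right q hs
        omega
    _ ≤ Ideal.span (Set.range x) ^ (s * q + 1) * I ^ N :=
        Ideal.pow_add_le_of_pow_succ_le hN _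
    _ ≤ Ideal.span (Set.range x) ^ (s * q + 1) := Ideal.mul_le_left
    _ ≤ ⨆ i ∈ (Finset.univ : Finset (Fin s)), Ideal.span {x i} ^ q := by
        rw [hspan]
        simpa using Ideal.iSup_pow_le_iSup_pow (fun i => Ideal.span {x i}) q Finset.univ
    _ ≤ frobeniusPower I q := by
        refine iSup₂_le fun i _ => ?_
        rw [Ideal.span_singleton_pow, Ideal.span_singleton_le_iff_mem]
        exact Ideal.subset_span ⟨x i, hx i, rfl⟩

section FrobeniusLinear

variable {R : Type*} [CommRing R]

theorem apply_mem_of_mem_frobeniusPower {q : ℕ} {φ : R →+ R}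
    (hφ : ∀ a x : R, φ (a ^ q * x) = a * φ x) {J : Ideal R} {x : R}
    (hx : x ∈ frobeniusPower J q) : φ x ∈ J := by
  suffices H : ∀ r, φ (r * x) ∈ J by simpa using H 1
  induction hx using Submodule.span_induction with
  | mem x h =>
    obtain ⟨a, ha, rfl⟩ := h
    intro r
    rw [mul_comm, hφ]
    exact J.mul_mem_right _ ha
  | zero => simp
  | add x y _ _ hx hy => intro r; rw [mul_add, map_add]; exact J.add_mem (hx r) (hy r)
  | smul c x _ hx => intro r; rw [smul_eq_mul, ← mul_assoc]; exact hx _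

theorem frobeniusPower_maximalIdeal_le_map (P : Ideal R) [P.IsPrime] (q : ℕ) :
    frobeniusPower (maximalIdeal (Localization.AtPrime P)) q ≤
      (frobeniusPower P q).map (algebraMap R (Localization.AtPrime P)) := by
  refine Ideal.span_le.mpr ?_
  rintro _ ⟨x, hx, rfl⟩
  obtain ⟨⟨a, s⟩, has⟩ := IsLocalization.surj P.primeCompl x
  have ha : a ∈ P := by
    rw [← Localization.AtPrime.under_maximalIdeal (I := P), Ideal.under_def, Ideal.mem_comap, ← has]
    exact Ideal.mul_mem_right _ _ hx
  have hs : IsUnit (algebraMap R (Localization.AtPrime P) s ^ q) :=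
    (IsLocalization.map_units _ s).pow q
  rw [SetLike.mem_coe, ← Ideal.mul_unit_mem_iff_mem _ hs]
  simp only at has ⊢
  rw [← mul_pow, has, ← map_pow]
  exact Ideal.mem_map_of_mem _ (Ideal.subset_span ⟨a, ha, rfl⟩)

theorem apply_mem_of_algebraMap_mem_frobeniusPower {q : ℕ} (hq : 0 < q) {φ : R →+ R}
    (hφ : ∀ a x : R, φ (a ^ q * x) = a * φ x) (P : Ideal R) [P.IsPrime] {x : R}
    (hx : algebraMap R (Localization.AtPrime P) x ∈
      frobeniusPower (maximalIdeal (Localization.AtPrime P)) q) : φ x ∈ P := by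
  obtain ⟨s, hs, hsx⟩ := (IsLocalization.algebraMap_mem_map_algebraMap_iff P.primeCompl
    (Localization.AtPrime P) _ x).mp (frobeniusPower_maximalIdeal_le_map P q hx)
  have h1 : φ (s ^ q * x) ∈ P := by
    refine apply_mem_of_mem_frobeniusPower hφ ?_
    rw [← Nat.sub_add_cancel hq, pow_succ, mul_assoc]
    exact Ideal.mul_mem_left _ _ (by rwa [Nat.sub_add_cancel hq])
  rw [hφ] at h1
  exact (Ideal.IsPrime.mem_or_mem ‹_› h1).resolve_left hs

/-- Iterating a `q`-inverse-linear map which does not send `w` into `P` yields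
`q ^ n`-inverse-linear maps which do not send the multiples of
`w ^ (1 + q + ⋯ + q ^ (n - 1))` into `P`. -/
theorem exists_iterate_apply_notMem {q : ℕ} (hq : 0 < q) {φ : R →+ R}
    (hφ : ∀ a x : R, φ (a ^ q * x) = a * φ x) (P : Ideal R) [P.IsPrime] {w : R}
    (hw : φ w ∉ P) (n : ℕ) :
    ∃ ψ : R →+ R, (∀ a x : R, ψ (a ^ q ^ n * x) = a * ψ x) ∧
      ∃ r, ψ (r * w ^ ∑ i ∈ Finset.range n, q ^ i) ∉ P := by
  induction n with
  | zero =>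
    exact ⟨AddMonoidHom.id R, by simp, 1, by
      simpa using (Ideal.ne_top_iff_one P).mp (Ideal.IsPrime.ne_top ‹_›)⟩
  | succ n ih =>
    obtain ⟨ψ, hψ, r, hr⟩ := ih
    refine ⟨ψ.comp φ, fun a x => ?_, (r * φ w ^ (q ^ n - 1)) ^ q, ?_⟩
    · rw [AddMonoidHom.comp_apply, pow_succ, pow_mul, hφ, hψ]
      rfl
    · set S := ∑ i ∈ Finset.range n, q ^ i
      have h1 : (r * φ w ^ (q ^ n - 1)) ^ q * w ^ ∑ i ∈ Finset.range (n + 1), q ^ i =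
          (r * φ w ^ (q ^ n - 1) * w ^ S) ^ q * w := by
        rw [geom_sum_succ, pow_succ, mul_pow _ (w ^ S), ← pow_mul w S, mul_comm q, mul_assoc]
      have h2 : r * φ w ^ (q ^ n - 1) * w ^ S * φ w = φ w ^ q ^ n * (r * w ^ S) := by
        conv_rhs => rw [← Nat.sub_add_cancel (Nat.pow_pos (n := n) hq), pow_succ]
        ring
      rw [h1, AddMonoidHom.comp_apply, hφ, h2, hψ]
      exact fun h => (Ideal.IsPrime.mem_or_mem ‹_› h).elim hw hr

theorem apply_mem_of_mem_pow {q h N : ℕ} (hq : 1 < q) {φ : R →+ R}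
    (hφ : ∀ a x : R, φ (a ^ q * x) = a * φ x) (P : Ideal R) [P.IsPrime]
    (hN : ∀ Q, maximalIdeal (Localization.AtPrime P) ^ (h * Q + N) ≤
      frobeniusPower (maximalIdeal (Localization.AtPrime P)) Q)
    {w : R} (hw : w ∈ P ^ (h * (q - 1) + 1)) : φ w ∈ P := by
  by_contra hwP
  obtain ⟨ψ, hψ, r, hr⟩ := exists_iterate_apply_notMem (by omega) hφ P hwP (h + N)
  refine hr (apply_mem_of_algebraMap_mem_frobeniusPower (Nat.pow_pos (by omega)) hψ P (hN _ ?_))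
  set S := ∑ i ∈ Finset.range (h + N), q ^ i with hS
  have hgeom : S * (q - 1) + 1 = q ^ (h + N) := by
    have := geom_sum_mul_add (q - 1) (h + N)
    rwa [Nat.sub_add_cancel hq.le] at this
  have hSn : h + N ≤ S := by
    calc h + N = ∑ _i ∈ Finset.range (h + N), 1 := by simp
      _ ≤ S := Finset.sum_le_sum fun i _ => Nat.one_le_pow _ _ (by omega)
  have hle : h * q ^ (h + N) + N ≤ (h * (q - 1) + 1) * S := by
    rw [← hgeom]
    calc h * (S * (q - 1) + 1) + N = h * (q - 1) * S + (h + N) := by ring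
      _ ≤ h * (q - 1) * S + S := by gcongr
      _ = (h * (q - 1) + 1) * S := by ring
  have hmem : r * w ^ S ∈ P ^ (h * q ^ (h + N) + N) := by
    refine Ideal.mul_mem_left _ _ (Ideal.pow_le_pow_right hle ?_)
    rw [pow_mul]
    exact Ideal.pow_mem_pow hw S
  rw [← Localization.AtPrime.map_eq_maximalIdeal, ← Ideal.map_pow]
  exact Ideal.mem_map_of_mem _ hmem

theorem infinite_residueField_of_ne_maximalIdeal [IsLocalRing R] {P : Ideal R} [P.IsPrime]
    (hP : P ≠ maximalIdeal R) : Infinite (ResidueField (Localization.AtPrime P)) := by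
  have hinf : Infinite (R ⧸ P) := by
    by_contra hfin
    rw [not_infinite_iff_finite] at hfin
    have := Ideal.Quotient.maximal_of_isField P (Finite.isField_of_domain (R ⧸ P))
    exact hP (eq_maximalIdeal this)
  exact Infinite.of_injective _ (Ideal.injective_algebraMap_quotient_residueField P)

theorem IsRegularLocal.exists_pow_le_frobeniusPower [IsLocalRing R] (hreg : IsRegularLocal R)
    (P : Ideal R) [P.IsPrime] {h : ℕ} (hP : P.height = h) :
    ∃ N, ∀ Q, maximalIdeal (Localization.AtPrime P) ^ (h * Q + N) ≤
      frobeniusPower (maximalIdeal (Localization.AtPrime P)) Q := by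
  obtain ⟨hnoeth, s, hs, hcard⟩ := hreg
  by_cases hPm : P = maximalIdeal R
  · have hsh : s.card = h := by
      rw [← maximalIdeal_height_eq_ringKrullDim, ← hPm, hP] at hcard
      exact_mod_cast hcard
    let x : Fin s.card → Localization.AtPrime P :=
      fun i => algebraMap R _ (s.equivFin.symm i : R)
    have hx : Ideal.span (Set.range x) = maximalIdeal (Localization.AtPrime P) := by
      have hPs : Ideal.span (s : Set R) = P := hs.trans hPm.symm
      rw [← Localization.AtPrime.map_eq_maximalIdeal, ← congrArg (Ideal.map _) hPs, Ideal.map_span]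
      congr 1
      ext y
      simp only [x, Set.mem_range, Set.mem_image]
      exact ⟨fun ⟨i, hi⟩ => ⟨_, (s.equivFin.symm i).2, hi⟩,
        fun ⟨r, hr, hry⟩ => ⟨s.equivFin ⟨r, hr⟩, by simpa using hry⟩⟩
    exact ⟨0 + 1, Ideal.pow_le_frobeniusPower_of_reduction (x := x) hsh.le
      (fun i => hx ▸ Ideal.subset_span (Set.mem_range_self i)) (by simp [hx])⟩
  · have := infinite_residueField_of_ne_maximalIdeal hPm
    have : IsNoetherianRing (Localization.AtPrime P) :=
      IsLocalization.isNoetherianRing P.primeCompl _ hnoeth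
    obtain ⟨t, ht, htcard⟩ := Ideal.exists_finset_card_eq_height_of_isNoetherianRing
      (maximalIdeal (Localization.AtPrime P))
    have hth : t.card = h := by
      have h1 := maximalIdeal_height_eq_ringKrullDim (R := Localization.AtPrime P)
      rw [IsLocalization.AtPrime.ringKrullDim_eq_height P, ← htcard, hP] at h1
      exact_mod_cast h1
    obtain ⟨l, hl, x, N, hx, hN⟩ := exists_reduction_maximalIdeal t ht
    exact ⟨N + 1, Ideal.pow_le_frobeniusPower_of_reduction (hl.trans hth.le) hx hN⟩

theorem SplitsAlong.quotient {I : Ideal R} {q : ℕ} {φ : R →+ R}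
    (hφ : ∀ a x : R, φ (a ^ q * x) = a * φ x) (hI : ∀ x ∈ I, φ x ∈ I) {g : R}
    (hg : φ g = 1) : SplitsAlong (R ⧸ I) (Ideal.Quotient.mk I g) q := by
  let φ' : R ⧸ I →+ R ⧸ I :=
    QuotientAddGroup.map I.toAddSubgroup I.toAddSubgroup φ hI
  have hφ' : ∀ x, φ' (Ideal.Quotient.mk I x) = Ideal.Quotient.mk I (φ x) := fun _ => rfl
  refine ⟨φ', fun a x => ?_, by rw [hφ', hg, map_one]⟩
  obtain ⟨a, rfl⟩ := Ideal.Quotient.mk_surjective a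
  obtain ⟨x, rfl⟩ := Ideal.Quotient.mk_surjective x
  rw [← map_pow, ← map_mul, hφ', hφ', hφ, map_mul]

theorem exists_isUnit_apply_mul [IsLocalRing R] {φ : R →+ R} {J B : Ideal R} {d : R}
    (hd : d ∈ J * B) (hφd : IsUnit (φ d)) : ∃ f ∈ J, ∃ g ∈ B, IsUnit (φ (f * g)) := by
  by_contra! H
  refine (mem_maximalIdeal (φ d)).mp ?_ hφd
  refine Submodule.mul_induction_on hd (fun f hf g hg => H f hf g hg) fun x y hx hy => ?_
  rw [map_add]
  exact Ideal.add_mem _ hx hy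

end FrobeniusLinear

/-- F-adjunction, F-pure case. If `(R, I^h a₁^{t₁} ⋯ a_k^{t_k})` is
F-pure, then `(S, (a₁S)^{t₁} ⋯ (a_kS)^{t_k})` is F-pure. -/
theorem fAdjunction_fPure {R : Type*} [CommRing R] [IsLocalRing R] (p : ℕ)
    [Fact p.Prime] [CharP R p] (hreg : IsRegularLocal R) (hFF : FFinite R p)
    (I : Ideal R) (hIne : I ≠ ⊤) (h : ℕ) (hh : 0 < h)
    (hI : UnmixedReducedOfHeight I h) {k : ℕ}
    (a : Fin k → Ideal R) (t : Fin k → ℝ) (ht : ∀ i, 0 < t i)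
    (hR : FPurePair R p (Fin.cons I a) (Fin.cons (h : ℝ) t)) :
    FPurePair (R ⧸ I) p (fun i => (a i).map (Ideal.Quotient.mk I)) t := by
  obtain ⟨e₀, he₀⟩ := hR
  refine ⟨e₀ + 1, fun e he => ?_⟩
  obtain ⟨d, hd, φ, hφ, hφd⟩ := he₀ e (by omega)
  have hq : 1 < p ^ e := Nat.one_lt_pow (by omega) (Fact.out : p.Prime).one_lt
  rw [Fin.prod_univ_succ] at hd
  simp only [Fin.cons_zero, Fin.cons_succ] at hd
  have hfloor : ⌊(h : ℝ) * ((p ^ e : ℝ) - 1)⌋₊ = h * (p ^ e - 1) := by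
    rw [← Nat.floor_natCast (R := ℝ) (h * (p ^ e - 1)), Nat.cast_mul, Nat.cast_sub hq.le]
    norm_num
  rw [hfloor] at hd
  obtain ⟨f, hf, g, hg, hu⟩ := exists_isUnit_apply_mul hd (hφd ▸ isUnit_one)
  obtain ⟨u, hu⟩ := hu.exists_left_inv
  let φ' : R →+ R := (AddMonoidHom.mulLeft u).comp (φ.comp (AddMonoidHom.mulLeft f))
  have hφ' : ∀ a x : R, φ' (a ^ p ^ e * x) = a * φ' x := by
    intro b x
    change u * φ (f * (b ^ p ^ e * x)) = b * (u * φ (f * x))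
    rw [mul_left_comm f, hφ, mul_left_comm]
  refine ⟨Ideal.Quotient.mk I g, ?_, SplitsAlong.quotient hφ' (fun x hx => ?_) hu⟩
  · simp only [← Ideal.map_pow]
    have hprod := Ideal.mem_map_of_mem (Ideal.Quotient.mk I) hg
    change _ ∈ Ideal.mapHom (Ideal.Quotient.mk I) _ at hprod
    rwa [map_prod] at hprod
  · refine I.mul_mem_left u ?_
    rw [← hI.1.radical, ← Ideal.sInf_minimalPrimes, Submodule.mem_sInf]
    intro (P : Ideal R) hP
    have hprime : P.IsPrime := hP.1.1
    have hheight : P.height = h :=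
      (PrimeSpectrum.height_eq_orderHeight ⟨P, hprime⟩).trans (hI.2 P hprime hP)
    obtain ⟨N, hN⟩ := hreg.exists_pow_le_frobeniusPower P hheight
    refine apply_mem_of_mem_pow hq hφ P hN (Ideal.pow_right_mono hP.1.2 _ ?_)
    rw [pow_succ]
    exact Ideal.mul_mem_mul hf hx
end
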